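/- arXiv:math/0607484 — 2 statements merged into one kernel-verified Lean document; each statement's English description precedes it below -/
import Mathlib

section
/- In ℝ⁴, the Sobolev space W^{1,1} embeds continuously into the Lorentz space L^{4/3,1}, and W^{2,1} embeds continuously into L^{2,1}. -/
open MeasureTheory Metric Set ENNReal NNReal

noncomputable section

/-- Four dimensional Euclidean space. -/
abbrev E4 : Type := EuclideanSpace ℝ (Fin 4)

/-- The `k`-th partial derivative of a function on `ℝ⁴`. -/
def pd {E : Type*} [NormedAddCommGroup E] [NormedSpace ℝ E] (k : Fin 4) (f : E4 → E) : E4 → E :=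
  fun x => fderiv ℝ f x (EuclideanSpace.single k 1)

/-- The Laplacian on `ℝ⁴`. -/
def lap {E : Type*} [NormedAddCommGroup E] [NormedSpace ℝ E] (f : E4 → E) : E4 → E :=
  fun x => ∑ k : Fin 4, pd k (pd k f) x

/-- The Bilaplacian on `ℝ⁴`. -/
def bilap {E : Type*} [NormedAddCommGroup E] [NormedSpace ℝ E] (f : E4 → E) : E4 → E :=
  lap (lap f)

/-- The distribution function `μ {|f| > s}`. -/
def distFn {α E : Type*} [MeasurableSpace α] [NormedAddCommGroup E]
    (μ : Measure α) (f : α → E) (s : ℝ≥0∞) : ℝ≥0∞ :=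
  μ {x | s < (‖f x‖₊ : ℝ≥0∞)}

/-- The decreasing rearrangement `f*` of `f`. -/
def rearr {α E : Type*} [MeasurableSpace α] [NormedAddCommGroup E]
    (μ : Measure α) (f : α → E) (t : ℝ) : ℝ≥0∞ :=
  sInf {s : ℝ≥0∞ | distFn μ f s ≤ ENNReal.ofReal t}

/-- The maximal rearrangement `f**(t) = t⁻¹ ∫₀ᵗ f*(s) ds`. -/
def rearrM {α E : Type*} [MeasurableSpace α] [NormedAddCommGroup E]
    (μ : Measure α) (f : α → E) (t : ℝ) : ℝ≥0∞ :=
  ENNReal.ofReal (1 / t) * ∫⁻ s in Set.Ioc (0 : ℝ) t, rearr μ f s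

/-- The Lorentz `L^{p,q}` norm `‖f‖_{L^{p,q}} = (∫₀^∞ (t^{1/p} f**(t))^q dt/t)^{1/q}`
(with the obvious supremum modification for `q = ∞`). -/
def lorentzNorm {α E : Type*} [MeasurableSpace α] [NormedAddCommGroup E]
    (p q : ℝ≥0∞) (μ : Measure α) (f : α → E) : ℝ≥0∞ :=
  if q = ∞ then
    ⨆ t : Set.Ioi (0 : ℝ), ENNReal.ofReal t.1 ^ (1 / p).toReal * rearrM μ f t.1
  else
    (∫⁻ t in Set.Ioi (0 : ℝ),
        (ENNReal.ofReal t ^ (1 / p).toReal * rearrM μ f t) ^ q.toReal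
          * ENNReal.ofReal (1 / t)) ^ (1 / q.toReal)

/-- Membership in the Lorentz space `L^{p,q}`. -/
def MemLorentz {α E : Type*} [MeasurableSpace α] [NormedAddCommGroup E]
    (p q : ℝ≥0∞) (μ : Measure α) (f : α → E) : Prop :=
  lorentzNorm p q μ f < ⊤

/-- The unit ball `B⁴ ⊆ ℝ⁴`. -/
def B1 : Set E4 := Metric.ball (0 : E4) 1

/-- The `W^{n,p}(Ω)` Sobolev norm of a function, `∑_{i ≤ n} ‖∇ⁱ f‖_{L^p(Ω)}`. -/
def sobNorm {E : Type*} [NormedAddCommGroup E] [NormedSpace ℝ E]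
    (n : ℕ) (p : ℝ≥0∞) (Ω : Set E4) (f : E4 → E) : ℝ≥0∞ :=
  ∑ i ∈ Finset.range (n + 1),
    eLpNorm (fun x => ‖iteratedFDeriv ℝ i f x‖) p (volume.restrict Ω)

/-- Core one-dimensional integral. -/
lemma core_int (a : ℝ) (ha0 : 0 < a) (ha1 : a < 1) (d : ℝ≥0∞) :
    ∫⁻ t in Set.Ioi (0 : ℝ), ENNReal.ofReal (t ^ (a - 2)) * min (ENNReal.ofReal t) d
      ≤ ENNReal.ofReal (1 / a + 1 / (1 - a)) * d ^ a := by
  have hK : 0 < 1 / a + 1 / (1 - a) := by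
    have : 0 < 1 - a := by linarith
    positivity
  rcases eq_or_ne d 0 with rfl | hd0
  · simp
  rcases eq_or_ne d ⊤ with rfl | hdt
  · rw [ENNReal.top_rpow_of_pos ha0, ENNReal.mul_top (by simpa using hK)]
    exact le_top
  obtain ⟨D, hD, rfl⟩ : ∃ D : ℝ, 0 < D ∧ d = ENNReal.ofReal D :=
    ⟨d.toReal, ENNReal.toReal_pos hd0 hdt, (ENNReal.ofReal_toReal hdt).symm⟩
  have hsplit : Set.Ioi (0 : ℝ) = Set.Ioc 0 D ∪ Set.Ioi D := (Ioc_union_Ioi_eq_Ioi hD.le).symm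
  rw [hsplit]
  refine (lintegral_union_le _ _ _).trans ?_
  have h1 : ∫⁻ t in Set.Ioc 0 D, ENNReal.ofReal (t ^ (a - 2)) * min (ENNReal.ofReal t) (ENNReal.ofReal D)
      ≤ ENNReal.ofReal (D ^ a / a) := by
    calc _ ≤ ∫⁻ t in Set.Ioc 0 D, ENNReal.ofReal (t ^ (a - 1)) := by
          refine setLIntegral_mono' measurableSet_Ioc fun t ht => ?_
          calc _ ≤ ENNReal.ofReal (t ^ (a - 2)) * ENNReal.ofReal t := by
                gcongr; exact min_le_left _ _
            _ = _ := by
                rw [← ENNReal.ofReal_mul (Real.rpow_nonneg ht.1.le _)]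
                congr 1
                conv_lhs => rw [← Real.rpow_one t, ← Real.rpow_mul ht.1.le, ← Real.rpow_add ht.1]
                congr 1; ring
      _ = ENNReal.ofReal (∫ t in Set.Ioc 0 D, t ^ (a - 1)) := by
          rw [ofReal_integral_eq_lintegral_ofReal]
          · exact (intervalIntegrable_iff_integrableOn_Ioc_of_le hD.le).1
              (intervalIntegral.intervalIntegrable_rpow' (by linarith))
          · filter_upwards [ae_restrict_mem measurableSet_Ioc] with t ht
            exact Real.rpow_nonneg ht.1.le _
      _ = _ := by
          rw [← intervalIntegral.integral_of_le hD.le, integral_rpow (Or.inl (by linarith))]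
          simp [Real.zero_rpow ha0.ne']
  have h2 : ∫⁻ t in Set.Ioi D, ENNReal.ofReal (t ^ (a - 2)) * min (ENNReal.ofReal t) (ENNReal.ofReal D)
      ≤ ENNReal.ofReal (D ^ a / (1 - a)) := by
    calc _ ≤ ∫⁻ t in Set.Ioi D, ENNReal.ofReal (t ^ (a - 2)) * ENNReal.ofReal D := by
          gcongr; exact min_le_right _ _
      _ = ENNReal.ofReal (∫ t in Set.Ioi D, t ^ (a - 2)) * ENNReal.ofReal D := by
          rw [lintegral_mul_const' _ _ ENNReal.ofReal_ne_top, ofReal_integral_eq_lintegral_ofReal]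
          · exact integrableOn_Ioi_rpow_of_lt (by linarith) hD
          · filter_upwards [ae_restrict_mem measurableSet_Ioi] with t ht
            exact Real.rpow_nonneg (hD.trans ht).le _
      _ = _ := by
          rw [integral_Ioi_rpow_of_lt (by linarith) hD, ← ENNReal.ofReal_mul]
          · congr 1
            have : D ^ a = D ^ (a - 2 + 1) * D := by
              conv_rhs => rw [← Real.rpow_add_one hD.ne']
              congr 1; ring
            rw [this]
            have h3 : 1 - a ≠ 0 := by linarith
            have h4 : a - 2 + 1 = -(1 - a) := by ring
            rw [h4, neg_div_neg_eq]
            field_simp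
          · have h4 : a - 2 + 1 = -(1 - a) := by ring
            rw [h4, neg_div_neg_eq]
            have : 0 < 1 - a := by linarith
            positivity
  refine (add_le_add h1 h2).trans_eq ?_
  have : 0 < 1 - a := by linarith
  rw [← ENNReal.ofReal_add (by positivity) (by positivity), ENNReal.ofReal_rpow_of_pos hD,
    ← ENNReal.ofReal_mul hK.le]
  congr 1
  ring

lemma distFn_anti {α E : Type*} [MeasurableSpace α] [NormedAddCommGroup E]
    (μ : Measure α) (f : α → E) : Antitone (distFn μ f) := by
  intro s t hst
  exact measure_mono fun x hx => lt_of_le_of_lt hst hx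

lemma rearr_anti {α E : Type*} [MeasurableSpace α] [NormedAddCommGroup E]
    (μ : Measure α) (f : α → E) : Antitone (rearr μ f) := by
  intro s t hst
  exact sInf_le_sInf fun x hx => le_trans hx (ENNReal.ofReal_le_ofReal hst)

lemma le_vol (R : ℝ≥0∞) : R ≤ volume {l : ℝ | 0 < l ∧ ENNReal.ofReal l < R} := by
  rcases eq_or_ne R ⊤ with rfl | hR
  · have : {l : ℝ | 0 < l ∧ ENNReal.ofReal l < ⊤} = Set.Ioi 0 := by ext; simp
    rw [this]; simp
  · have : {l : ℝ | 0 < l ∧ ENNReal.ofReal l < R} = Set.Ioo 0 R.toReal := by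
      ext l
      simp only [mem_ofPred_eq, mem_Ioo]
      refine and_congr_right fun hl => ?_
      rw [ENNReal.ofReal_lt_iff_lt_toReal hl.le hR]
    rw [this]; simp [ENNReal.ofReal_toReal hR]

lemma rearr_le {α E : Type*} [MeasurableSpace α] [NormedAddCommGroup E]
    (μ : Measure α) (f : α → E) (t : ℝ) :
    rearr μ f t ≤ ∫⁻ l in Set.Ioi (0 : ℝ),
      {l : ℝ | ENNReal.ofReal t < distFn μ f (ENNReal.ofReal l)}.indicator 1 l := by
  have hm : Measurable fun l : ℝ => distFn μ f (ENNReal.ofReal l) :=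
    ((distFn_anti μ f).comp_monotone ENNReal.ofReal_mono).measurable
  rw [lintegral_indicator_one (measurableSet_lt measurable_const hm),
    Measure.restrict_apply (measurableSet_lt measurable_const hm)]
  refine (le_vol _).trans (measure_mono ?_)
  rintro l ⟨hl, hlt⟩
  refine ⟨?_, hl⟩
  by_contra hcon
  have hcon2 : distFn μ f (ENNReal.ofReal l) ≤ ENNReal.ofReal t := not_lt.1 hcon
  exact absurd hlt (not_lt.2 (sInf_le hcon2))

lemma lorentz_le {α E : Type*} [MeasurableSpace α] [NormedAddCommGroup E]
    (μ : Measure α) (f : α → E) (p : ℝ≥0∞) (a : ℝ) (hp : (1 / p).toReal = a)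
    (ha0 : 0 < a) (ha1 : a < 1) :
    lorentzNorm p 1 μ f ≤ ENNReal.ofReal (1 / a + 1 / (1 - a)) *
      ∫⁻ l in Set.Ioi (0 : ℝ), (distFn μ f (ENNReal.ofReal l)) ^ a := by
  have hm : Measurable fun l : ℝ => distFn μ f (ENNReal.ofReal l) :=
    ((distFn_anti μ f).comp_monotone ENNReal.ofReal_mono).measurable
  unfold lorentzNorm
  rw [if_neg ENNReal.one_ne_top, hp]
  simp only [ENNReal.toReal_one, ENNReal.rpow_one, div_one]
  have hint : ∀ t : ℝ, 0 < t → ∫⁻ s in Set.Ioc (0 : ℝ) t, rearr μ f s ≤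
      ∫⁻ l in Set.Ioi (0 : ℝ), min (ENNReal.ofReal t) (distFn μ f (ENNReal.ofReal l)) := by
    intro t ht
    calc _ ≤ ∫⁻ s in Set.Ioc (0 : ℝ) t, ∫⁻ l in Set.Ioi (0 : ℝ),
          {q : ℝ × ℝ | ENNReal.ofReal q.1 < distFn μ f (ENNReal.ofReal q.2)}.indicator 1 (s, l) :=
          lintegral_mono fun s => rearr_le μ f s
      _ = ∫⁻ l in Set.Ioi (0 : ℝ), ∫⁻ s in Set.Ioc (0 : ℝ) t,
          {q : ℝ × ℝ | ENNReal.ofReal q.1 < distFn μ f (ENNReal.ofReal q.2)}.indicator 1 (s, l) := by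
          rw [lintegral_lintegral_swap]
          refine Measurable.aemeasurable ?_
          exact measurable_one.indicator
            (measurableSet_lt (ENNReal.measurable_ofReal.comp measurable_fst) (hm.comp measurable_snd))
      _ ≤ _ := by
          refine lintegral_mono fun l => ?_
          have hms : MeasurableSet {s : ℝ | ENNReal.ofReal s < distFn μ f (ENNReal.ofReal l)} :=
            measurableSet_lt ENNReal.measurable_ofReal measurable_const
          change ∫⁻ s in Set.Ioc (0 : ℝ) t,
            {s : ℝ | ENNReal.ofReal s < distFn μ f (ENNReal.ofReal l)}.indicator 1 s ≤ _
          rw [lintegral_indicator_one hms, Measure.restrict_apply hms]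
          refine le_min ?_ ?_
          · refine (measure_mono inter_subset_right).trans ?_
            simp
          · set d := distFn μ f (ENNReal.ofReal l)
            rcases eq_or_ne d ⊤ with h | h
            · rw [h]; exact le_top
            · refine (measure_mono (t := Set.Ioo 0 d.toReal) ?_).trans ?_
              · rintro s ⟨h1, h2⟩
                exact ⟨h2.1, (ENNReal.ofReal_lt_iff_lt_toReal h2.1.le h).1 h1⟩
              · simp [ENNReal.ofReal_toReal h]
  calc _ ≤ ∫⁻ t in Set.Ioi (0 : ℝ), ∫⁻ l in Set.Ioi (0 : ℝ), ENNReal.ofReal (t ^ (a - 2)) *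
        min (ENNReal.ofReal t) (distFn μ f (ENNReal.ofReal l)) := by
        refine setLIntegral_mono' measurableSet_Ioi fun t (ht : 0 < t) => ?_
        rw [lintegral_const_mul' _ _ ENNReal.ofReal_ne_top]
        unfold rearrM
        have : ENNReal.ofReal (t ^ (a - 2)) =
            ENNReal.ofReal t ^ a * ENNReal.ofReal (1 / t) * ENNReal.ofReal (1 / t) := by
          rw [ENNReal.ofReal_rpow_of_pos ht, ← ENNReal.ofReal_mul (by positivity),
            ← ENNReal.ofReal_mul (by positivity), Real.rpow_sub ht]
          congr 1
          rw [Real.rpow_two]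
          field_simp
        rw [this]
        calc _ = ENNReal.ofReal t ^ a * ENNReal.ofReal (1 / t) * ENNReal.ofReal (1 / t) *
              ∫⁻ s in Set.Ioc (0 : ℝ) t, rearr μ f s := by ring
          _ ≤ _ := mul_le_mul_right (hint t ht) _
    _ = ∫⁻ l in Set.Ioi (0 : ℝ), ∫⁻ t in Set.Ioi (0 : ℝ), ENNReal.ofReal (t ^ (a - 2)) *
        min (ENNReal.ofReal t) (distFn μ f (ENNReal.ofReal l)) := by
        rw [lintegral_lintegral_swap]
        refine Measurable.aemeasurable ?_
        refine Measurable.mul ?_ ?_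
        · exact ENNReal.measurable_ofReal.comp (measurable_fst.pow_const _)
        · exact (ENNReal.measurable_ofReal.comp measurable_fst).min (hm.comp measurable_snd)
    _ ≤ ∫⁻ l in Set.Ioi (0 : ℝ), ENNReal.ofReal (1 / a + 1 / (1 - a)) *
          (distFn μ f (ENNReal.ofReal l)) ^ a :=
        lintegral_mono fun l => core_int a ha0 ha1 _
    _ = _ := lintegral_const_mul' _ _ ENNReal.ofReal_ne_top

lemma theta_bound : ∃ B : ℝ, 0 < B ∧ ∀ r, |deriv Real.smoothTransition r| ≤ B ∧
    ((r ≤ 0 ∨ 1 ≤ r) → deriv Real.smoothTransition r = 0) := by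
  have hz : ∀ r : ℝ, (r ≤ 0 ∨ 1 ≤ r) → deriv Real.smoothTransition r = 0 := by
    rintro r (h | h)
    · refine IsLocalMin.deriv_eq_zero (Filter.Eventually.of_forall fun y => ?_)
      rw [Real.smoothTransition.zero_of_nonpos h]
      exact Real.smoothTransition.nonneg y
    · refine IsLocalMax.deriv_eq_zero (Filter.Eventually.of_forall fun y => ?_)
      rw [Real.smoothTransition.one_of_one_le h]
      exact Real.smoothTransition.le_one y
  have hc : Continuous (deriv Real.smoothTransition) :=
    (Real.smoothTransition.contDiff (n := 1)).continuous_deriv (by norm_num)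
  obtain ⟨B, hB⟩ := (isCompact_Icc (a := (0 : ℝ)) (b := 1)).exists_bound_of_continuousOn
    hc.continuousOn
  refine ⟨max B 1, by positivity, fun r => ⟨?_, hz r⟩⟩
  by_cases hr : r ∈ Set.Icc (0 : ℝ) 1
  · exact (hB r hr).trans (le_max_left _ _)
  · have : r ≤ 0 ∨ 1 ≤ r := by
      by_contra! h
      exact hr ⟨h.1.le, h.2.le⟩
    rw [hz r this]; simp

lemma gns : ∃ C : ℝ≥0, ∀ v : E4 → ℝ, ContDiff ℝ 1 v → HasCompactSupport v →
    (∫⁻ x, ‖v x‖ₑ ^ (4 / 3 : ℝ)) ^ (3 / 4 : ℝ) ≤ C * ∫⁻ x, ‖fderiv ℝ v x‖ₑ := by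
  refine ⟨(lintegralPowLePowLIntegralFDerivConst (volume : Measure E4) (4 / 3)) ^ (3 / 4 : ℝ),
    fun v hv hc => ?_⟩
  have hp : Real.HolderConjugate (Module.finrank ℝ E4) (4 / 3 : ℝ) := by
    rw [finrank_euclideanSpace_fin]
    rw [Real.holderConjugate_iff]
    norm_num
  have := lintegral_pow_le_pow_lintegral_fderiv (volume : Measure E4) hv hc hp
  refine (ENNReal.rpow_le_rpow this (by norm_num : (0 : ℝ) ≤ 3 / 4)).trans_eq ?_
  rw [ENNReal.mul_rpow_of_nonneg _ _ (by norm_num), ← ENNReal.rpow_mul,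
    ENNReal.coe_rpow_of_nonneg _ (by norm_num)]
  norm_num

/-- Truncation estimate. -/
lemma trunc : ∃ C : ℝ≥0, ∀ {F : Type} [NormedAddCommGroup F] [InnerProductSpace ℝ F] (f : E4 → F),
    ContDiff ℝ 1 f → HasCompactSupport f → ∀ a : ℝ, 0 < a →
    ENNReal.ofReal a * (volume {x | 2 * a < ‖f x‖}) ^ (3 / 4 : ℝ)
      ≤ C * ∫⁻ x in {x | a < ‖f x‖ ∧ ‖f x‖ ≤ 2 * a}, ‖fderiv ℝ f x‖ₑ := by
  obtain ⟨C, hC⟩ := gns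
  obtain ⟨B, hB0, hB⟩ := theta_bound
  refine ⟨C * (2 * B).toNNReal, ?_⟩
  intro F _ _ f hf hfc a ha
  set w : E4 → ℝ := fun x => (‖f x‖ ^ 2 - a ^ 2) / (3 * a ^ 2) with hw
  set v : E4 → ℝ := fun x => Real.smoothTransition (w x) with hv
  have hwd : ContDiff ℝ 1 w := ((hf.norm_sq ℝ).sub contDiff_const).div_const _
  have hvd : ContDiff ℝ 1 v := (Real.smoothTransition.contDiff (n := 1)).comp hwd
  have hvc : HasCompactSupport v := by
    refine hfc.mono fun x hx => ?_
    rw [Function.mem_support] at hx ⊢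
    contrapose! hx
    simp only [hv, hw, hx]
    apply Real.smoothTransition.zero_of_nonpos
    simp only [norm_zero]
    apply div_nonpos_of_nonpos_of_nonneg <;> nlinarith [sq_nonneg a]
  have hms : MeasurableSet {x | a < ‖f x‖ ∧ ‖f x‖ ≤ 2 * a} :=
    (measurableSet_lt measurable_const hf.continuous.norm.measurable).inter
      (measurableSet_le hf.continuous.norm.measurable measurable_const)
  -- pointwise derivative bound
  have hder : ∀ x, ‖fderiv ℝ v x‖ₑ ≤ {x | a < ‖f x‖ ∧ ‖f x‖ ≤ 2 * a}.indicator
      (fun x => ENNReal.ofReal (2 * B / a) * ‖fderiv ℝ f x‖ₑ) x := by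
    intro x
    have hdf : DifferentiableAt ℝ f x := (hf.differentiable (by norm_num)) x
    have hfw : HasFDerivAt w ((3 * a ^ 2)⁻¹ • (2 • (innerSL ℝ (f x)).comp (fderiv ℝ f x))) x := by
      have h1 := (hdf.hasFDerivAt.norm_sq).sub_const (a ^ 2)
      have h2 := h1.const_mul ((3 * a ^ 2)⁻¹)
      refine h2.congr_of_eventuallyEq (Filter.Eventually.of_forall fun y => ?_)
      simp only [hw]; ring
    have hθ : HasDerivAt Real.smoothTransition (deriv Real.smoothTransition (w x)) (w x) :=
      (((Real.smoothTransition.contDiff (n := 1)).differentiable (by norm_num)) _).hasDerivAt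
    have hfv : fderiv ℝ v x = deriv Real.smoothTransition (w x) •
        ((3 * a ^ 2)⁻¹ • (2 • (innerSL ℝ (f x)).comp (fderiv ℝ f x))) :=
      (hθ.comp_hasFDerivAt x hfw).fderiv
    by_cases hx : a < ‖f x‖ ∧ ‖f x‖ ≤ 2 * a
    · rw [indicator_of_mem (show x ∈ {x | a < ‖f x‖ ∧ ‖f x‖ ≤ 2 * a} from hx), ← ofReal_norm, ← ofReal_norm,
        ← ENNReal.ofReal_mul (by positivity)]
      apply ENNReal.ofReal_le_ofReal
      rw [hfv, norm_smul, norm_smul, Real.norm_eq_abs, Real.norm_eq_abs,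
        abs_of_pos (by positivity : 0 < (3 * a ^ 2)⁻¹)]
      have h3 : ‖(2 • (innerSL ℝ (f x)).comp (fderiv ℝ f x) : E4 →L[ℝ] ℝ)‖ ≤
          2 * (2 * a * ‖fderiv ℝ f x‖) := by
        rw [two_smul, two_mul]
        have h4 : ‖((innerSL ℝ (f x)).comp (fderiv ℝ f x) : E4 →L[ℝ] ℝ)‖ ≤
            2 * a * ‖fderiv ℝ f x‖ := by
          refine (ContinuousLinearMap.opNorm_comp_le _ _).trans ?_
          rw [innerSL_apply_norm]
          gcongr
          exact hx.2
        exact (norm_add_le _ _).trans (add_le_add h4 h4)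
      calc _ ≤ B * ((3 * a ^ 2)⁻¹ * (2 * (2 * a * ‖fderiv ℝ f x‖))) := by
            gcongr
            exact (hB _).1
        _ = (4 / 3) * (B / a * ‖fderiv ℝ f x‖) := by field_simp; ring
        _ ≤ 2 * (B / a * ‖fderiv ℝ f x‖) := by gcongr; norm_num
        _ = _ := by ring
    · have h0 : deriv Real.smoothTransition (w x) = 0 := by
        apply (hB _).2
        by_cases h : a < ‖f x‖
        · right
          have h5 : 2 * a < ‖f x‖ := by
            by_contra h6
            exact hx ⟨h, not_lt.1 h6⟩
          simp only [hw]
          rw [le_div_iff₀ (by positivity)]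
          nlinarith
        · left
          simp only [hw]
          apply div_nonpos_of_nonpos_of_nonneg
          · nlinarith [norm_nonneg (f x), not_lt.1 h]
          · positivity
      rw [← ofReal_norm, hfv, h0, zero_smul, ContinuousLinearMap.opNorm_zero, ENNReal.ofReal_zero]
      exact zero_le
  have h1 : (volume {x | 2 * a < ‖f x‖}) ≤ ∫⁻ x, ‖v x‖ₑ ^ (4 / 3 : ℝ) := by
    have hm2 : MeasurableSet {x | 2 * a < ‖f x‖} :=
      measurableSet_lt measurable_const hf.continuous.norm.measurable
    rw [← lintegral_indicator_one hm2]
    refine lintegral_mono fun x => ?_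
    by_cases hx : 2 * a < ‖f x‖
    · rw [indicator_of_mem (show x ∈ {x | 2 * a < ‖f x‖} from hx)]
      have : v x = 1 := by
        apply Real.smoothTransition.one_of_one_le
        simp only [hw]
        rw [le_div_iff₀ (by positivity)]
        nlinarith
      rw [this]; simp
    · rw [indicator_of_notMem (show x ∉ {x | 2 * a < ‖f x‖} from hx)]
      exact zero_le
  have h2 := (ENNReal.rpow_le_rpow h1 (by norm_num : (0 : ℝ) ≤ 3 / 4)).trans (hC v hvd hvc)
  have h3 : ∫⁻ x, ‖fderiv ℝ v x‖ₑ ≤ ENNReal.ofReal (2 * B / a) *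
      ∫⁻ x in {x | a < ‖f x‖ ∧ ‖f x‖ ≤ 2 * a}, ‖fderiv ℝ f x‖ₑ := by
    refine (lintegral_mono hder).trans ?_
    rw [lintegral_indicator hms, lintegral_const_mul' _ _ ENNReal.ofReal_ne_top]
  calc _ ≤ ENNReal.ofReal a * (C * (ENNReal.ofReal (2 * B / a) *
      ∫⁻ x in {x | a < ‖f x‖ ∧ ‖f x‖ ≤ 2 * a}, ‖fderiv ℝ f x‖ₑ)) := by
        gcongr
        exact h2.trans (by gcongr)
    _ = C * (ENNReal.ofReal a * ENNReal.ofReal (2 * B / a)) *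
      ∫⁻ x in {x | a < ‖f x‖ ∧ ‖f x‖ ≤ 2 * a}, ‖fderiv ℝ f x‖ₑ := by ring
    _ = _ := by
      rw [← ENNReal.ofReal_mul ha.le, ENNReal.coe_mul]
      have : a * (2 * B / a) = 2 * B := by field_simp
      rw [this]; rfl

lemma dyadic (φ : ℝ → ℝ≥0∞) (hφ : Antitone φ) :
    ∫⁻ l in Set.Ioi (0 : ℝ), φ l ≤ ∑' k : ℤ, ENNReal.ofReal (2 ^ k) * φ (2 ^ k) := by
  have hsub : Set.Ioi (0 : ℝ) ⊆ ⋃ k : ℤ, Set.Ico ((2 : ℝ) ^ k) (2 ^ (k + 1)) := by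
    intro x hx
    obtain ⟨n, hn⟩ := exists_mem_Ico_zpow (show (0 : ℝ) < x from hx) one_lt_two
    exact mem_iUnion.2 ⟨n, hn⟩
  refine (lintegral_mono_set hsub).trans ((lintegral_iUnion_le _ _).trans ?_)
  refine ENNReal.tsum_le_tsum fun k => ?_
  calc _ ≤ ∫⁻ l in Set.Ico ((2 : ℝ) ^ k) (2 ^ (k + 1)), φ (2 ^ k) :=
        setLIntegral_mono' measurableSet_Ico fun t ht => hφ ht.1
    _ = _ := by
        rw [setLIntegral_const, Real.volume_Ico, zpow_add_one₀ (by norm_num), mul_comm]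
        congr 2; ring

/-- dyadic layers -/
def lay {F : Type} [NormedAddCommGroup F] (f : E4 → F) (k : ℤ) : Set E4 :=
  {x | (2 : ℝ) ^ k < ‖f x‖ ∧ ‖f x‖ ≤ 2 * 2 ^ k}

lemma lay_disj {F : Type} [NormedAddCommGroup F] (f : E4 → F) :
    Pairwise (Function.onFun Disjoint (lay f)) := by
  have key : ∀ i j : ℤ, i < j → Disjoint (lay f i) (lay f j) := by
    intro i j hij
    rw [Set.disjoint_left]
    rintro x ⟨_, h1⟩ ⟨h2, _⟩
    have : (2 : ℝ) ^ (i + 1) ≤ 2 ^ j := zpow_le_zpow_right₀ (by norm_num) (by omega)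
    rw [zpow_add_one₀ (by norm_num)] at this
    linarith
  intro i j hij
  rcases lt_or_gt_of_ne hij with h | h
  · exact key i j h
  · exact (key j i h).symm

lemma lay_meas {F : Type} [NormedAddCommGroup F] (f : E4 → F) (hf : Continuous f) (k : ℤ) :
    MeasurableSet (lay f k) :=
  (measurableSet_lt measurable_const hf.norm.measurable).inter
      (measurableSet_le hf.norm.measurable measurable_const)

lemma vol_anti {F : Type} [NormedAddCommGroup F] (f : E4 → F) :
    Antitone fun l : ℝ => volume {x | l < ‖f x‖} := by
  intro s t hst
  exact measure_mono fun x (hx : t < ‖f x‖) => (lt_of_le_of_lt hst hx : s < ‖f x‖)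

lemma shift_sum (M : ℤ → ℝ≥0∞) :
    ∑' k : ℤ, ENNReal.ofReal (2 ^ k) * M k = 2 * ∑' k : ℤ, ENNReal.ofReal (2 ^ k) * M (k + 1) := by
  rw [← (Equiv.addRight (1 : ℤ)).tsum_eq, ← ENNReal.tsum_mul_left]
  refine tsum_congr fun k => ?_
  simp only [Equiv.coe_addRight]
  rw [zpow_add_one₀ (by norm_num), ENNReal.ofReal_mul (by positivity)]
  simp only [ENNReal.ofReal_ofNat]
  ring

lemma first_emb : ∃ C : ℝ≥0, ∀ {F : Type} [NormedAddCommGroup F] [InnerProductSpace ℝ F]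
    (f : E4 → F), ContDiff ℝ 1 f → HasCompactSupport f →
    ∫⁻ l in Set.Ioi (0 : ℝ), (volume {x | l < ‖f x‖}) ^ (3 / 4 : ℝ)
      ≤ C * ∫⁻ x, ‖fderiv ℝ f x‖ₑ := by
  obtain ⟨C, hC⟩ := trunc
  refine ⟨2 * C, ?_⟩
  intro F _ _ f hf hfc
  refine (dyadic (fun l => (volume {x | l < ‖f x‖}) ^ (3 / 4 : ℝ)) fun s t hst =>
    ENNReal.rpow_le_rpow (vol_anti f hst) (by norm_num)).trans ?_
  rw [shift_sum (fun k => (volume {x | (2 : ℝ) ^ k < ‖f x‖}) ^ (3 / 4 : ℝ)),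
    ENNReal.coe_mul, mul_assoc]
  refine mul_le_mul_right ?_ _
  calc _ ≤ ∑' k : ℤ, C * ∫⁻ x in lay f k, ‖fderiv ℝ f x‖ₑ := by
        refine ENNReal.tsum_le_tsum fun k => ?_
        have := hC f hf hfc (2 ^ k) (by positivity)
        rw [zpow_add_one₀ (by norm_num), mul_comm ((2 : ℝ) ^ k) 2]
        exact this
    _ = C * ∫⁻ x in ⋃ k, lay f k, ‖fderiv ℝ f x‖ₑ := by
        rw [ENNReal.tsum_mul_left,
          lintegral_iUnion (lay_meas f hf.continuous) (lay_disj f)]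
    _ ≤ _ := mul_le_mul_right (setLIntegral_le_lintegral _ _) _

lemma sum_layers_le {F : Type} [NormedAddCommGroup F] (f : E4 → F) (hf : Continuous f)
    (G : Set E4) (hG : MeasurableSet G) (r : ℝ≥0∞) :
    ∑' k : ℤ, (if volume {x | (2 : ℝ) ^ k < ‖f x‖} < r then volume (lay f k ∩ G) else 0)
      ≤ min r (volume G) := by
  classical
  set P : ℤ → Prop := fun k => volume {x | (2 : ℝ) ^ k < ‖f x‖} < r with hP
  have h1 : ∑' k : ℤ, (if P k then volume (lay f k ∩ G) else 0) =
      volume (⋃ k : ℤ, if P k then lay f k ∩ G else ∅) := by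
    rw [measure_iUnion]
    · refine tsum_congr fun k => ?_
      split_ifs <;> simp
    · intro i j hij
      simp only [Function.onFun]
      split_ifs
      · exact (lay_disj f hij).mono inter_subset_left inter_subset_left
      all_goals simp
    · intro k
      split_ifs
      · exact (lay_meas f hf k).inter hG
      · exact MeasurableSet.empty
  change ∑' k : ℤ, (if P k then volume (lay f k ∩ G) else 0) ≤ _
  rw [h1]
  refine le_min ?_ ?_
  · have hsub : (⋃ k : ℤ, if P k then lay f k ∩ G else ∅) ⊆
        ⋃ k : ℤ, if P k then {x | (2 : ℝ) ^ k < ‖f x‖} else ∅ := by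
      refine iUnion_mono fun k => ?_
      split_ifs
      · intro x hx
        exact hx.1.1
      · exact le_rfl
    refine (measure_mono hsub).trans ?_
    rw [Directed.measure_iUnion]
    · refine iSup_le fun k => ?_
      split_ifs with h
      · exact le_of_lt h
      · simp
    · have key : ∀ i j : ℤ, i ≤ j → ∃ z : ℤ,
          (if P i then {x | (2 : ℝ) ^ i < ‖f x‖} else ∅) ⊆
            (if P z then {x | (2 : ℝ) ^ z < ‖f x‖} else ∅) ∧
          (if P j then {x | (2 : ℝ) ^ j < ‖f x‖} else ∅) ⊆
            (if P z then {x | (2 : ℝ) ^ z < ‖f x‖} else ∅) := by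
        intro i j hij
        by_cases hi : P i
        · refine ⟨i, le_rfl, ?_⟩
          rw [if_pos hi]
          split_ifs
          · intro x (hx : (2 : ℝ) ^ j < ‖f x‖)
            exact lt_of_le_of_lt (zpow_le_zpow_right₀ (by norm_num) hij) hx
          · exact empty_subset _
        · refine ⟨j, ?_, le_rfl⟩
          rw [if_neg hi]
          exact empty_subset _
      intro i j
      rcases le_total i j with h | h
      · exact key i j h
      · obtain ⟨z, h1, h2⟩ := key j i h
        exact ⟨z, h2, h1⟩
  · refine measure_mono (iUnion_subset fun k => ?_)
    split_ifs
    · exact inter_subset_right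
    · exact empty_subset _

lemma pow_le_int (M : ℝ≥0∞) (h0 : M ≠ 0) :
    M ^ (-(1 / 4) : ℝ) ≤ ENNReal.ofReal (2 ^ (5 / 4 : ℝ)) *
      ∫⁻ r in Set.Ioi (0 : ℝ), ENNReal.ofReal (r ^ ((3 / 4 : ℝ) - 2)) *
        (if M < ENNReal.ofReal r then 1 else 0) := by
  rcases eq_or_ne M ⊤ with rfl | ht
  · rw [ENNReal.top_rpow_of_neg (by norm_num)]; exact zero_le
  obtain ⟨m, hm, rfl⟩ : ∃ D : ℝ, 0 < D ∧ M = ENNReal.ofReal D :=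
    ⟨M.toReal, ENNReal.toReal_pos h0 ht, (ENNReal.ofReal_toReal ht).symm⟩
  have h1 : ENNReal.ofReal ((2 * m) ^ (-(5 / 4) : ℝ) * m) ≤
      ∫⁻ r in Set.Ioi (0 : ℝ), ENNReal.ofReal (r ^ ((3 / 4 : ℝ) - 2)) *
        (if ENNReal.ofReal m < ENNReal.ofReal r then 1 else 0) := by
    calc _ = ∫⁻ r in Set.Ioc m (2 * m), ENNReal.ofReal ((2 * m) ^ (-(5 / 4) : ℝ)) := by
          rw [setLIntegral_const, Real.volume_Ioc, ENNReal.ofReal_mul (by positivity)]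
          congr 2; ring
      _ ≤ ∫⁻ r in Set.Ioc m (2 * m), ENNReal.ofReal (r ^ ((3 / 4 : ℝ) - 2)) *
        (if ENNReal.ofReal m < ENNReal.ofReal r then 1 else 0) := by
          refine setLIntegral_mono' measurableSet_Ioc fun r hr => ?_
          have hr0 : 0 < r := hm.trans hr.1
          rw [if_pos ((ENNReal.ofReal_lt_ofReal_iff hr0).2 hr.1), mul_one]
          apply ENNReal.ofReal_le_ofReal
          have : (3 / 4 : ℝ) - 2 = -(5 / 4) := by norm_num
          rw [this]
          exact Real.rpow_le_rpow_of_nonpos hr0 hr.2 (by norm_num)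
      _ ≤ _ := lintegral_mono_set fun r hr => hm.trans hr.1
  refine le_trans (le_of_eq ?_) (mul_le_mul_right h1 _)
  rw [ENNReal.ofReal_rpow_of_pos hm, ← ENNReal.ofReal_mul (by positivity)]
  congr 1
  rw [Real.mul_rpow (by norm_num) hm.le, mul_assoc, ← mul_assoc, ← Real.rpow_add (by norm_num),
    ← Real.rpow_add_one hm.ne']
  norm_num

lemma hardy {F : Type} [NormedAddCommGroup F] (f : E4 → F) (hf : Continuous f)
    (G : Set E4) (hG : MeasurableSet G) :
    ∑' k : ℤ, (volume {x | (2 : ℝ) ^ k < ‖f x‖}) ^ (-(1 / 4) : ℝ) * volume (lay f k ∩ G)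
      ≤ ENNReal.ofReal (2 ^ (5 / 4 : ℝ)) * (ENNReal.ofReal (1 / (3 / 4) + 1 / (1 - 3 / 4)) *
        volume G ^ (3 / 4 : ℝ)) := by
  set M : ℤ → ℝ≥0∞ := fun k => volume {x | (2 : ℝ) ^ k < ‖f x‖} with hM
  have hmi : ∀ k, Measurable fun r : ℝ => (if M k < ENNReal.ofReal r then (1 : ℝ≥0∞) else 0) :=
    fun k => Measurable.ite (measurableSet_lt measurable_const ENNReal.measurable_ofReal)
      measurable_const measurable_const
  have hmr : Measurable fun r : ℝ => ENNReal.ofReal (r ^ ((3 / 4 : ℝ) - 2)) :=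
    ENNReal.measurable_ofReal.comp (measurable_id.pow_const _)
  calc _ ≤ ∑' k : ℤ, ENNReal.ofReal (2 ^ (5 / 4 : ℝ)) *
      ∫⁻ r in Set.Ioi (0 : ℝ), ENNReal.ofReal (r ^ ((3 / 4 : ℝ) - 2)) *
        (if M k < ENNReal.ofReal r then volume (lay f k ∩ G) else 0) := by
        refine ENNReal.tsum_le_tsum fun k => ?_
        by_cases h0 : M k = 0
        · have : volume (lay f k ∩ G) = 0 :=
            measure_mono_null (fun x hx => hx.1.1) h0
          rw [this, mul_zero]; exact zero_le
        · refine (mul_le_mul_left (pow_le_int (M k) h0) _).trans_eq ?_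
          rw [mul_assoc]
          have hmul : Measurable fun r : ℝ => ENNReal.ofReal (r ^ ((3 / 4 : ℝ) - 2)) *
              (if M k < ENNReal.ofReal r then (1 : ℝ≥0∞) else 0) := hmr.mul (hmi k)
          rw [← lintegral_mul_const _ hmul]
          congr 1
          refine lintegral_congr fun r => ?_
          split_ifs <;> simp
    _ = ENNReal.ofReal (2 ^ (5 / 4 : ℝ)) *
      ∫⁻ r in Set.Ioi (0 : ℝ), ENNReal.ofReal (r ^ ((3 / 4 : ℝ) - 2)) *
        ∑' k : ℤ, (if M k < ENNReal.ofReal r then volume (lay f k ∩ G) else 0) := by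
        rw [ENNReal.tsum_mul_left, ← lintegral_tsum]
        · congr 1
          refine lintegral_congr fun r => ?_
          rw [ENNReal.tsum_mul_left]
        · intro k
          refine (hmr.mul ?_).aemeasurable
          exact Measurable.ite (measurableSet_lt measurable_const ENNReal.measurable_ofReal)
            measurable_const measurable_const
    _ ≤ _ := by
        refine mul_le_mul_right ?_ _
        refine le_trans (lintegral_mono fun r => ?_)
          (core_int (3 / 4) (by norm_num) (by norm_num) (volume G))
        exact mul_le_mul_right (sum_layers_le f hf G hG _) _

lemma term_ineq (w M M' I C : ℝ≥0∞) (hM : M ≠ ⊤) (hMM : M' ≤ M)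
    (h : w * M' ^ (3 / 4 : ℝ) ≤ C * I) :
    w * M' ^ (1 / 2 : ℝ) ≤ 4⁻¹ * (w * M ^ (1 / 2 : ℝ)) + 2 * C * (M ^ (-(1 / 4) : ℝ) * I) := by
  have h16 : (16 : ℝ≥0∞) = 2 ^ (4 : ℝ) := by
    rw [show (4 : ℝ) = ((4 : ℕ) : ℝ) by norm_num, ENNReal.rpow_natCast]; norm_num
  have hM' : M' ≠ ⊤ := ne_top_of_le_ne_top hM hMM
  by_cases hc : 16 * M' ≤ M
  · refine le_trans ?_ le_self_add
    have h1 := ENNReal.rpow_le_rpow hc (by norm_num : (0 : ℝ) ≤ 1 / 2)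
    rw [ENNReal.mul_rpow_of_nonneg _ _ (by norm_num), h16, ← ENNReal.rpow_mul] at h1
    have h4 : (2 : ℝ≥0∞) ^ ((4 : ℝ) * (1 / 2)) = 4 := by
      rw [show (4 : ℝ) * (1 / 2) = ((2 : ℕ) : ℝ) by norm_num, ENNReal.rpow_natCast]; norm_num
    rw [h4] at h1
    calc _ = 4⁻¹ * (w * (4 * M' ^ (1 / 2 : ℝ))) := by
          rw [mul_left_comm w 4, ← mul_assoc, ENNReal.inv_mul_cancel (by norm_num) (by norm_num),
            one_mul]
      _ ≤ _ := by gcongr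
  · refine le_trans ?_ le_add_self
    push Not at hc
    have h0 : M' ≠ 0 := by
      rintro rfl
      simp at hc
    have h1 : M' ^ (1 / 2 : ℝ) = M' ^ (3 / 4 : ℝ) * M' ^ (-(1 / 4) : ℝ) := by
      rw [← ENNReal.rpow_add _ _ h0 hM']; norm_num
    have h2 : M' ^ (-(1 / 4) : ℝ) ≤ 2 * M ^ (-(1 / 4) : ℝ) := by
      rw [ENNReal.rpow_neg, ENNReal.rpow_neg]
      have h3 := ENNReal.rpow_le_rpow hc.le (by norm_num : (0 : ℝ) ≤ 1 / 4)
      rw [ENNReal.mul_rpow_of_nonneg _ _ (by norm_num), h16, ← ENNReal.rpow_mul] at h3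
      norm_num at h3
      rw [← ENNReal.inv_le_inv, ENNReal.mul_inv (by simp) (by simp)] at h3
      calc (M' ^ (1 / 4 : ℝ))⁻¹ = 2 * (2⁻¹ * (M' ^ (1 / 4 : ℝ))⁻¹) := by
            rw [← mul_assoc, ENNReal.mul_inv_cancel (by norm_num) (by norm_num), one_mul]
        _ ≤ _ := by
            norm_num
            gcongr
    calc _ = (w * M' ^ (3 / 4 : ℝ)) * M' ^ (-(1 / 4) : ℝ) := by rw [h1, mul_assoc]
      _ ≤ (C * I) * (2 * M ^ (-(1 / 4) : ℝ)) := mul_le_mul' h h2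
      _ = _ := by ring

lemma finite_sum (V : ℝ≥0∞) (hV : V ≠ ⊤) (N : ℕ) (M : ℤ → ℝ≥0∞) (hM : ∀ k, M k ≤ V)
    (h0 : ∀ k : ℤ, N ≤ k → M k = 0) :
    ∑' k : ℤ, ENNReal.ofReal (2 ^ k) * M k ≠ ⊤ := by
  have hs : Summable fun k : ℤ => if k < N then (2 : ℝ) ^ k else 0 := by
    refine Summable.of_nat_of_neg ?_ ?_
    · refine summable_of_ne_finset_zero (s := Finset.range N) fun n hn => ?_
      rw [Finset.mem_range] at hn
      rw [if_neg (by omega)]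
    · refine Summable.of_nonneg_of_le (fun n => ?_) (fun n => ?_)
        (summable_geometric_of_lt_one (r := (1 / 2 : ℝ)) (by norm_num) (by norm_num))
      · split_ifs <;> positivity
      · split_ifs
        · rw [zpow_neg, zpow_natCast, one_div, inv_pow]
        · positivity
  refine ne_top_of_le_ne_top (ENNReal.mul_ne_top hs.tsum_ofReal_ne_top hV) ?_
  rw [← ENNReal.tsum_mul_right]
  refine ENNReal.tsum_le_tsum fun k => ?_
  split_ifs with h
  · exact mul_le_mul_right (hM k) _
  · rw [h0 k (by omega)]; simp

lemma second_emb : ∃ C : ℝ≥0, ∀ (f : E4 → ℝ), ContDiff ℝ 1 f → HasCompactSupport f →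
    ∫⁻ l in Set.Ioi (0 : ℝ), (volume {x | l < ‖f x‖}) ^ (1 / 2 : ℝ)
      ≤ C * ∫⁻ s in Set.Ioi (0 : ℝ), (volume {x | s < ‖fderiv ℝ f x‖}) ^ (3 / 4 : ℝ) := by
  obtain ⟨C, hC⟩ := trunc
  set K : ℝ := 2 ^ (5 / 4 : ℝ) * (1 / (3 / 4) + 1 / (1 - 3 / 4)) with hK
  refine ⟨8 * C * K.toNNReal, ?_⟩
  intro f hf hfc
  have hcg : Continuous fun x => ‖fderiv ℝ f x‖ := (hf.continuous_fderiv (by norm_num)).norm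
  set M : ℤ → ℝ≥0∞ := fun k => volume {x | (2 : ℝ) ^ k < ‖f x‖} with hM
  set I : ℤ → ℝ≥0∞ := fun k => ∫⁻ x in lay f k, ‖fderiv ℝ f x‖ₑ with hI
  have hV : volume (tsupport f) ≠ ⊤ := hfc.isCompact.measure_lt_top.ne
  have hMV : ∀ k, M k ≤ volume (tsupport f) := by
    intro k
    refine measure_mono fun x (hx : (2 : ℝ) ^ k < ‖f x‖) => ?_
    apply subset_tsupport
    rw [Function.mem_support]
    intro h
    rw [h, norm_zero] at hx
    exact absurd hx (not_lt.2 (by positivity))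
  -- finiteness
  have hfin : ∑' k : ℤ, ENNReal.ofReal (2 ^ k) * M k ^ (1 / 2 : ℝ) ≠ ⊤ := by
    obtain ⟨R, hR⟩ := hf.continuous.bounded_above_of_compact_support hfc
    obtain ⟨N, hN⟩ := pow_unbounded_of_one_lt R (one_lt_two (α := ℝ))
    refine finite_sum (volume (tsupport f) ^ (1 / 2 : ℝ))
      (ENNReal.rpow_ne_top_of_nonneg (by norm_num) hV) N _
      (fun k => ENNReal.rpow_le_rpow (hMV k) (by norm_num)) fun k hk => ?_
    have : M k = 0 := by
      have hE : {x | (2 : ℝ) ^ k < ‖f x‖} = ∅ := by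
        refine eq_empty_of_forall_notMem fun x (hx : (2 : ℝ) ^ k < ‖f x‖) => ?_
        have h1 : (2 : ℝ) ^ (N : ℤ) ≤ 2 ^ k := zpow_le_zpow_right₀ (by norm_num) hk
        rw [zpow_natCast] at h1
        linarith [hR x]
      simp only [hM, hE, measure_empty]
    rw [this]; simp
  -- Hardy
  have hT : ∑' k, M k ^ (-(1 / 4) : ℝ) * I k ≤ ENNReal.ofReal K *
      ∫⁻ s in Set.Ioi (0 : ℝ), (volume {x | s < ‖fderiv ℝ f x‖}) ^ (3 / 4 : ℝ) := by
    have hmG : ∀ s : ℝ, MeasurableSet {x | s < ‖fderiv ℝ f x‖} := fun s =>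
      measurableSet_lt measurable_const hcg.measurable
    have hmm : ∀ k, Measurable fun s : ℝ => volume (lay f k ∩ {x | s < ‖fderiv ℝ f x‖}) := by
      intro k
      refine Antitone.measurable fun s t hst => measure_mono ?_
      exact inter_subset_inter_right _ fun x (hx : t < _) => (hst.trans_lt hx : s < _)
    have hIk : ∀ k, I k = ∫⁻ s in Set.Ioi (0 : ℝ),
        volume (lay f k ∩ {x | s < ‖fderiv ℝ f x‖}) := by
      intro k
      have h1 := lintegral_eq_lintegral_meas_lt (volume.restrict (lay f k))
        (f := fun x => ‖fderiv ℝ f x‖) (Filter.Eventually.of_forall fun x => norm_nonneg _)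
        hcg.measurable.aemeasurable
      simp only [ofReal_norm] at h1
      simp only [hI]
      rw [h1]
      refine lintegral_congr fun s => ?_
      rw [Measure.restrict_apply (hmG s), inter_comm]
    calc _ = ∫⁻ s in Set.Ioi (0 : ℝ), ∑' k, M k ^ (-(1 / 4) : ℝ) *
          volume (lay f k ∩ {x | s < ‖fderiv ℝ f x‖}) := by
          rw [lintegral_tsum fun k => ((hmm k).const_mul _).aemeasurable]
          refine tsum_congr fun k => ?_
          rw [lintegral_const_mul _ (hmm k), hIk]
      _ ≤ ∫⁻ s in Set.Ioi (0 : ℝ), ENNReal.ofReal K *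
          (volume {x | s < ‖fderiv ℝ f x‖}) ^ (3 / 4 : ℝ) := by
          refine lintegral_mono fun s => ?_
          refine (hardy f hf.continuous _ (hmG s)).trans_eq ?_
          rw [← mul_assoc, ← ENNReal.ofReal_mul (by positivity)]
      _ = _ := lintegral_const_mul' _ _ ENNReal.ofReal_ne_top
  refine (dyadic (fun l => (volume {x | l < ‖f x‖}) ^ (1 / 2 : ℝ)) fun s t hst =>
    ENNReal.rpow_le_rpow (vol_anti f hst) (by norm_num)).trans ?_
  set S := ∑' k : ℤ, ENNReal.ofReal (2 ^ k) * M k ^ (1 / 2 : ℝ) with hS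
  set T := ∑' k, M k ^ (-(1 / 4) : ℝ) * I k with hTdef
  have hST : S ≤ 2⁻¹ * S + 4 * C * T := by
    calc S = 2 * ∑' k : ℤ, ENNReal.ofReal (2 ^ k) * M (k + 1) ^ (1 / 2 : ℝ) :=
          shift_sum (fun k => M k ^ (1 / 2 : ℝ))
      _ ≤ 2 * ∑' k : ℤ, (4⁻¹ * (ENNReal.ofReal (2 ^ k) * M k ^ (1 / 2 : ℝ)) +
          2 * C * (M k ^ (-(1 / 4) : ℝ) * I k)) := by
          refine mul_le_mul_right (ENNReal.tsum_le_tsum fun k => ?_) _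
          refine term_ineq _ _ _ _ _ (ne_top_of_le_ne_top hV (hMV k)) ?_ ?_
          · exact vol_anti f (zpow_le_zpow_right₀ (by norm_num) (by omega))
          · have := hC f hf hfc (2 ^ k) (by positivity)
            simp only [hM]
            rw [zpow_add_one₀ (by norm_num), mul_comm ((2 : ℝ) ^ k) 2]
            exact this
      _ = 2 * 4⁻¹ * S + 4 * C * T := by
          rw [ENNReal.tsum_add, ENNReal.tsum_mul_left, ENNReal.tsum_mul_left]
          ring
      _ = _ := by
          congr 2
          rw [show (4 : ℝ≥0∞) = 2 * 2 by norm_num, ENNReal.mul_inv (by simp) (by simp),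
            ← mul_assoc, ENNReal.mul_inv_cancel (by norm_num) (by norm_num), one_mul]
  have hST2 : 2⁻¹ * S ≤ 4 * C * T := by
    have h2 : 2⁻¹ * S + 2⁻¹ * S = S := by
      rw [← add_mul, ENNReal.inv_two_add_inv_two, one_mul]
    have h3 : 2⁻¹ * S + 2⁻¹ * S ≤ 2⁻¹ * S + 4 * C * T := h2.trans_le hST
    exact (ENNReal.add_le_add_iff_left (ENNReal.mul_ne_top (by simp) hfin)).1 h3
  calc S = 2 * (2⁻¹ * S) := by
        rw [← mul_assoc, ENNReal.mul_inv_cancel (by norm_num) (by norm_num), one_mul]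
    _ ≤ 2 * (4 * C * T) := mul_le_mul_right hST2 _
    _ ≤ 2 * (4 * C * (ENNReal.ofReal K *
      ∫⁻ s in Set.Ioi (0 : ℝ), (volume {x | s < ‖fderiv ℝ f x‖}) ^ (3 / 4 : ℝ))) := by
        gcongr
    _ = _ := by
        rw [ENNReal.coe_mul, ENNReal.coe_mul]
        change _ = ((8 : ℝ≥0) : ℝ≥0∞) * C * ENNReal.ofReal K * _
        rw [show ((8 : ℝ≥0) : ℝ≥0∞) = 2 * 4 by norm_num]
        ring

/-- Riesz map as a real linear isometry. -/
def rieszI : (E4 →L[ℝ] ℝ) →ₗᵢ[ℝ] E4 where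
  toFun φ := (InnerProductSpace.toDual ℝ E4).symm φ
  map_add' := by intro x y; exact map_add _ _ _
  map_smul' := by intro c x; simp
  norm_map' := by intro x; exact LinearIsometryEquiv.norm_map _ _

lemma dist_le (u : E4 → ℝ) (a : ℝ) (ha : 0 ≤ a) :
    ∫⁻ l in Set.Ioi (0 : ℝ), (distFn volume u (ENNReal.ofReal l)) ^ a ≤
    ∫⁻ l in Set.Ioi (0 : ℝ), (volume {x | l < ‖u x‖}) ^ a := by
  refine lintegral_mono fun l => ENNReal.rpow_le_rpow (measure_mono fun x hx => ?_) ha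
  have hx' : ENNReal.ofReal l < ‖u x‖ₑ := hx
  rw [← ofReal_norm] at hx'
  exact (ENNReal.ofReal_lt_ofReal_iff'.1 hx').1

/-- Poornima's endpoint Sobolev embeddings in `ℝ⁴`.
`W^{1,1}(ℝ⁴) ↪ L^{4/3,1}(ℝ⁴)` and `W^{2,1}(ℝ⁴) ↪ L^{2,1}(ℝ⁴)`: for compactly supported
smooth `u`, `‖u‖_{L^{4/3,1}} ≤ C ‖∇u‖_{L¹}` and `‖u‖_{L^{2,1}} ≤ C ‖∇²u‖_{L¹}`. -/
theorem stmt10 :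
    ∃ C : ℝ≥0, 0 < C ∧
      ∀ u : E4 → ℝ, ContDiff ℝ (⊤ : ℕ∞) u → HasCompactSupport u →
        lorentzNorm (4 / 3) 1 (volume : Measure E4) u
            ≤ C * eLpNorm (fun x => ‖fderiv ℝ u x‖) 1 volume
          ∧ lorentzNorm 2 1 (volume : Measure E4) u
            ≤ C * eLpNorm (fun x => ‖iteratedFDeriv ℝ 2 u x‖) 1 volume := by
  obtain ⟨C1, h1⟩ := first_emb
  obtain ⟨C2, h2⟩ := second_emb
  set K1 : ℝ≥0 := (1 / (3 / 4 : ℝ) + 1 / (1 - 3 / 4)).toNNReal with hK1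
  set K2 : ℝ≥0 := (1 / (1 / 2 : ℝ) + 1 / (1 - 1 / 2)).toNNReal with hK2
  refine ⟨K1 * C1 + K2 * (C2 * C1) + 1, by positivity, fun u hu huc => ⟨?_, ?_⟩⟩
  · have hp : (1 / (4 / 3 : ℝ≥0∞)).toReal = 3 / 4 := by
      simp [ENNReal.toReal_div]
    calc lorentzNorm (4 / 3) 1 volume u ≤ K1 * (C1 * ∫⁻ x, ‖fderiv ℝ u x‖ₑ) := by
          refine (lorentz_le volume u (4 / 3) (3 / 4) hp (by norm_num) (by norm_num)).trans ?_
          refine mul_le_mul_right ((dist_le u _ (by norm_num)).trans ?_) _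
          exact h1 u (hu.of_le (by exact_mod_cast le_top)) huc
      _ = (K1 * C1 : ℝ≥0) * ∫⁻ x, ‖fderiv ℝ u x‖ₑ := by rw [ENNReal.coe_mul, mul_assoc]
      _ ≤ _ := by
          rw [eLpNorm_one_eq_lintegral_enorm]
          simp only [enorm_norm]
          refine mul_le_mul_left (ENNReal.coe_le_coe.2 ?_) _
          rw [add_assoc]
          exact le_self_add
  · have hp : (1 / (2 : ℝ≥0∞)).toReal = 1 / 2 := by
      simp [ENNReal.toReal_div]
    have hdu : ContDiff ℝ 1 (fderiv ℝ u) :=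
      (contDiff_infty.1 hu 2).fderiv_right (by norm_num)
    set g : E4 → E4 := fun x => rieszI (fderiv ℝ u x) with hg
    have hgd : ContDiff ℝ 1 g := rieszI.toContinuousLinearMap.contDiff.comp hdu
    have hgc : HasCompactSupport g := by
      refine (huc.fderiv ℝ).comp_left (g := rieszI) (map_zero _)
    have hgn : ∀ x, ‖g x‖ = ‖fderiv ℝ u x‖ := fun x => rieszI.norm_map _
    have hdg : ∀ x, ‖fderiv ℝ g x‖ₑ ≤ ‖iteratedFDeriv ℝ 2 u x‖ₑ := by
      intro x
      have hd : HasFDerivAt g (rieszI.toContinuousLinearMap.comp (fderiv ℝ (fderiv ℝ u) x)) x :=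
        rieszI.toContinuousLinearMap.hasFDerivAt.comp x
          ((hdu.differentiable (by norm_num)) x).hasFDerivAt
      rw [hd.fderiv, ← ofReal_norm, ← ofReal_norm]
      apply ENNReal.ofReal_le_ofReal
      have h3 : ‖fderiv ℝ (fderiv ℝ u) x‖ = ‖iteratedFDeriv ℝ 2 u x‖ := by
        rw [← norm_iteratedFDeriv_fderiv, norm_iteratedFDeriv_one]
      rw [← h3]
      refine ContinuousLinearMap.opNorm_le_bound _ (ContinuousLinearMap.opNorm_nonneg _) fun y => ?_
      have h4 : ‖(rieszI.toContinuousLinearMap.comp (fderiv ℝ (fderiv ℝ u) x)) y‖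
          = ‖fderiv ℝ (fderiv ℝ u) x y‖ := rieszI.norm_map _
      rw [h4]
      exact ContinuousLinearMap.le_opNorm _ _
    calc lorentzNorm 2 1 volume u
        ≤ K2 * (C2 * (C1 * ∫⁻ x, ‖iteratedFDeriv ℝ 2 u x‖ₑ)) := by
          refine (lorentz_le volume u 2 (1 / 2) hp (by norm_num) (by norm_num)).trans ?_
          refine mul_le_mul_right ((dist_le u _ (by norm_num)).trans ?_) _
          refine (h2 u (hu.of_le (by exact_mod_cast le_top)) huc).trans ?_
          refine mul_le_mul_right ?_ _
          have h5 := h1 g hgd hgc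
          simp only [hgn] at h5
          exact h5.trans (mul_le_mul_right (lintegral_mono hdg) _)
      _ = (K2 * (C2 * C1) : ℝ≥0) * ∫⁻ x, ‖iteratedFDeriv ℝ 2 u x‖ₑ := by
          rw [ENNReal.coe_mul, ENNReal.coe_mul]; ring
      _ ≤ _ := by
          rw [eLpNorm_one_eq_lintegral_enorm]
          simp only [enorm_norm]
          refine mul_le_mul_left (ENNReal.coe_le_coe.2 ?_) _
          rw [add_assoc, add_left_comm]
          exact le_self_add
end
end

section
/- (Fourth-order Wente estimate, second part) Let u₂ ∈ C^∞(closure of B⁴, ℝᵐ) solve −Δ²u₂ = div f in B⁴ with u₂ = ∂Δu₂/∂ν = 0 on ∂B⁴ and ∫Δu₂ = 0, where f ∈ L^{4/3,1}(B⁴, ℝ^{4m}). Then ‖u₂‖_{L^∞} ≤ C(‖∇Δu₂‖_{L^{4/3,1}} + ‖u₂‖_{W^{2,2}}). -/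
open MeasureTheory Metric Set ENNReal NNReal

noncomputable section

open Filter Topology

lemma compact_pd {f : E4 → ℝ} (hf : HasCompactSupport f) (k : Fin 4) : HasCompactSupport (pd k f) := by
  exact hf.fderiv_apply ℝ _

lemma cont_pd {f : E4 → ℝ} (hf : ContDiff ℝ 1 f) (k : Fin 4) : Continuous (pd k f) := by
  exact (hf.continuous_fderiv (by norm_num)).clm_apply continuous_const

lemma deriv_st_zero {t : ℝ} (h : t ≤ 0 ∨ 1 ≤ t) : deriv Real.smoothTransition t = 0 := by
  rcases h with h | h
  · apply IsLocalMin.deriv_eq_zero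
    refine Filter.Eventually.of_forall fun s => ?_
    rw [Real.smoothTransition.zero_of_nonpos h]
    exact Real.smoothTransition.nonneg s
  · apply IsLocalMax.deriv_eq_zero
    refine Filter.Eventually.of_forall fun s => ?_
    rw [Real.smoothTransition.one_of_one_le h]
    exact Real.smoothTransition.le_one s

lemma deriv_st_bound : ∃ M : ℝ, 0 ≤ M ∧ ∀ t, 0 ≤ deriv Real.smoothTransition t ∧
    deriv Real.smoothTransition t ≤ M := by
  have hc : Continuous (deriv Real.smoothTransition) :=
    (Real.smoothTransition.contDiff (n := 1)).continuous_deriv (by norm_num)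
  obtain ⟨M, hM⟩ := (isCompact_Icc (a := (0:ℝ)) (b := 1)).exists_bound_of_continuousOn hc.continuousOn
  have h0 : ∀ t, 0 ≤ deriv Real.smoothTransition t := fun t =>
    Real.smoothTransition.monotone.deriv_nonneg
  have hM0 : 0 ≤ M := (norm_nonneg _).trans (hM 0 (by simp))
  refine ⟨M, hM0, fun t => ⟨h0 t, ?_⟩⟩
  by_cases ht : t ∈ Icc (0:ℝ) 1
  · exact (le_abs_self _).trans (hM t ht)
  · rw [deriv_st_zero]
    · exact hM0
    · simp only [mem_Icc, not_and_or, not_le] at ht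
      rcases ht with h | h
      · exact Or.inl h.le
      · exact Or.inr h.le

lemma hasFDerivAt_nsq (a y : E4) : HasFDerivAt (fun z : E4 => ‖z - a‖ ^ 2)
    ((2:ℝ) • (innerSL ℝ (y - a))) y := by
  have := ((hasFDerivAt_id y).sub_const a).norm_sq
  have e : (2:ℝ) • (innerSL ℝ (y - a))
      = (2:ℕ) • (innerSL ℝ (id y - a)).comp (ContinuousLinearMap.id ℝ E4) := by
    rw [ContinuousLinearMap.comp_id, two_smul, two_smul]; rfl
  rw [e]
  exact this

lemma inner_single (z : E4) (k : Fin 4) : inner ℝ z (EuclideanSpace.single k (1:ℝ)) = z k := by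
  simp [EuclideanSpace.inner_single_right]

lemma pd_cut (a : E4) (R c : ℝ) (k : Fin 4) (y : E4) :
    pd k (fun y => Real.smoothTransition (c * (R ^ 2 - ‖y - a‖ ^ 2))) y
      = - (2 * c * deriv Real.smoothTransition (c * (R ^ 2 - ‖y - a‖ ^ 2)) * (y k - a k)) := by
  have h1 := ((hasFDerivAt_nsq a y).const_sub (R^2)).const_mul c
  have h2 : HasDerivAt Real.smoothTransition (deriv Real.smoothTransition (c * (R ^ 2 - ‖y - a‖ ^ 2)))
      (c * (R ^ 2 - ‖y - a‖ ^ 2)) :=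
    ((Real.smoothTransition.contDiff (n := 1)).differentiable (by norm_num) _).hasDerivAt
  have h3 := h2.comp_hasFDerivAt y h1
  unfold pd
  have : fderiv ℝ (fun y => Real.smoothTransition (c * (R ^ 2 - ‖y - a‖ ^ 2))) y = _ := h3.fderiv
  rw [this]
  simp only [_root_.smul_apply, _root_.neg_apply, innerSL_apply_apply,
    inner_single, smul_eq_mul, PiLp.sub_apply]
  ring

lemma ibp {η f : E4 → ℝ} (hη : ContDiff ℝ 1 η) (hc : HasCompactSupport η) (hf : ContDiff ℝ 1 f)
    (k : Fin 4) : ∫ y, η y * pd k f y = - ∫ y, pd k η y * f y := by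
  apply integral_mul_fderiv_eq_neg_fderiv_mul_of_integrable
  · exact ((cont_pd hη k).mul hf.continuous).integrable_of_hasCompactSupport
      ((compact_pd hc k).mul_right)
  · exact (hη.continuous.mul (cont_pd hf k)).integrable_of_hasCompactSupport (hc.mul_right)
  · exact (hη.continuous.mul hf.continuous).integrable_of_hasCompactSupport (hc.mul_right)
  · exact fun x _ => hη.differentiable (by norm_num) x
  · exact fun x _ => hf.differentiable (by norm_num) x

lemma flux_bound (a : E4) {R : ℝ} (hR : 0 < R) (Φ : E4 → ℝ) (hΦ : ContDiff ℝ 1 Φ) (h0 : Φ a = 0)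
    (hb : ∀ y, ‖y - a‖ = R → Φ y ≤ 0) :
    ∃ L : ℝ, 0 ≤ L ∧ ∀ y, ‖y - a‖ ≤ R → Φ y ≤ L * (R ^ 2 - ‖y - a‖ ^ 2) := by
  obtain ⟨K, hK⟩ := (isCompact_closedBall a R).exists_bound_of_continuousOn
    (hΦ.continuous_fderiv (by norm_num)).continuousOn
  have hK0 : 0 ≤ K := (norm_nonneg _).trans (hK a (by simp [hR.le]))
  refine ⟨K / R, by positivity, fun y hy => ?_⟩
  by_cases hya : y = a
  · subst hya; rw [h0]; simp; positivity
  have hp : 0 < ‖y - a‖ := norm_pos_iff.2 (sub_ne_zero.2 hya)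
  set y' : E4 := a + (R / ‖y - a‖) • (y - a) with hy'
  have e1 : ‖y' - a‖ = R := by
    simp only [hy', add_sub_cancel_left, norm_smul, norm_div, Real.norm_eq_abs, abs_of_pos hR, abs_of_pos hp]
    field_simp
  have e2 : ‖y - y'‖ = R - ‖y - a‖ := by
    have : y - y' = (1 - R / ‖y - a‖) • (y - a) := by
      rw [hy', sub_smul, one_smul]; abel
    rw [this, norm_smul, Real.norm_eq_abs, abs_sub_comm, abs_of_nonneg]
    · field_simp
    · rw [sub_nonneg, le_div_iff₀ hp]; linarith
  have := (convex_closedBall a R).norm_image_sub_le_of_norm_fderiv_le (𝕜 := ℝ) (f := Φ) (C := K)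
    (fun x _ => hΦ.differentiable (by norm_num) x) (fun x hx => hK x hx)
    (x := y') (y := y) (by simp [dist_eq_norm, e1]) (by simpa [dist_eq_norm] using hy)
  rw [e2] at this
  have h3 := (le_abs_self _).trans this
  have h4 := hb y' e1
  have h5 : K * (R - ‖y - a‖) ≤ K / R * (R ^ 2 - ‖y - a‖ ^ 2) := by
    rw [div_mul_eq_mul_div, le_div_iff₀ hR]
    nlinarith [mul_nonneg hK0 (mul_nonneg (sub_nonneg.2 hy) hp.le)]
  linarith

lemma div_le (a : E4) {R : ℝ} (hR : 0 < R) (F : Fin 4 → E4 → ℝ) (hF : ∀ k, ContDiff ℝ 1 (F k))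
    (hb : ∀ y, ‖y - a‖ = R → ∑ k, F k y * (y k - a k) ≤ 0) :
    ∫ y in ball a R, ∑ k, pd k (F k) y ≤ 0 := by
  set D : E4 → ℝ := fun y => ∑ k, pd k (F k) y with hD
  have hDc : Continuous D := continuous_finsetSum _ fun k _ => cont_pd (hF k) k
  set Φ : E4 → ℝ := fun y => ∑ k, F k y * (y k - a k) with hΦ
  have hΦc : ContDiff ℝ 1 Φ := by
    apply ContDiff.sum; intro k _
    have := hF k
    fun_prop
  obtain ⟨L, hL0, hL⟩ := flux_bound a hR Φ hΦc (by simp [hΦ]) hb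
  obtain ⟨M, hM0, hM⟩ := deriv_st_bound
  set η : ℕ → E4 → ℝ := fun n y => Real.smoothTransition ((n:ℝ) * (R ^ 2 - ‖y - a‖ ^ 2)) with hη
  have hηs : ∀ n, ContDiff ℝ 1 (η n) := fun n => by
    apply Real.smoothTransition.contDiff.comp
    have : ContDiff ℝ 1 (fun y : E4 => ‖y - a‖ ^ 2) := (contDiff_id.sub contDiff_const).norm_sq ℝ
    exact contDiff_const.mul (contDiff_const.sub this)
  have hη0 : ∀ n y, y ∉ ball a R → η n y = 0 := fun n y hy => by
    apply Real.smoothTransition.zero_of_nonpos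
    rw [mem_ball, dist_eq_norm, not_lt] at hy
    have : R ^ 2 ≤ ‖y - a‖ ^ 2 := by gcongr
    exact mul_nonpos_of_nonneg_of_nonpos (Nat.cast_nonneg n) (by linarith)
  have hηc : ∀ n, HasCompactSupport (η n) := fun n =>
    HasCompactSupport.intro (isCompact_closedBall a R) fun y hy =>
      hη0 n y fun h => hy (ball_subset_closedBall h)
  set S : ℕ → Set E4 := fun n => {y | 0 < (n:ℝ) * (R ^ 2 - ‖y - a‖ ^ 2) ∧ (n:ℝ) * (R ^ 2 - ‖y - a‖ ^ 2) < 1} with hS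
  have hSm : ∀ n, MeasurableSet (S n) := fun n => by
    have hm : Measurable fun y : E4 => (n:ℝ) * (R ^ 2 - ‖y - a‖ ^ 2) := by fun_prop
    exact (measurableSet_lt measurable_const hm).inter (measurableSet_lt hm measurable_const)
  have hSb : ∀ n, S n ⊆ ball a R := fun n y hy => by
    rw [mem_ball, dist_eq_norm]
    have h1 : 0 < R ^ 2 - ‖y - a‖ ^ 2 := pos_of_mul_pos_right hy.1 (Nat.cast_nonneg n)
    exact lt_of_pow_lt_pow_left₀ 2 hR.le (by linarith)
  have key : ∀ n, ∫ y, η n y * D y ≤ ∫ y, (S n).indicator (fun _ => 2 * M * L) y := fun n => by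
    have h1 : ∫ y, η n y * D y = ∫ y, 2 * n * deriv Real.smoothTransition ((n:ℝ) * (R ^ 2 - ‖y - a‖ ^ 2)) * Φ y := by
      simp only [hD, Finset.mul_sum]
      rw [integral_finsetSum]
      · simp_rw [ibp (hηs n) (hηc n) (hF _)]
        rw [Finset.sum_neg_distrib, ← integral_finsetSum, ← integral_neg]
        · congr 1; ext y
          simp only [hη, pd_cut, hΦ, Finset.mul_sum, ← Finset.sum_neg_distrib]
          refine Finset.sum_congr rfl fun k _ => ?_
          ring
        · intro k _
          exact ((cont_pd (hηs n) k).mul (hF k).continuous).integrable_of_hasCompactSupport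
            ((compact_pd (hηc n) k).mul_right)
      · intro k _
        exact ((hηs n).continuous.mul (cont_pd (hF k) k)).integrable_of_hasCompactSupport ((hηc n).mul_right)
    rw [h1]
    have hle : ∀ y, 2 * n * deriv Real.smoothTransition ((n:ℝ) * (R ^ 2 - ‖y - a‖ ^ 2)) * Φ y
        ≤ (S n).indicator (fun _ => 2 * M * L) y := fun y => by
      by_cases hy : y ∈ S n
      · rw [indicator_of_mem hy]
        have hyR : ‖y - a‖ ≤ R := by simpa [dist_eq_norm] using (mem_ball.1 (hSb n hy)).le
        have h2 := hL y hyR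
        have h3 := hM ((n:ℝ) * (R ^ 2 - ‖y - a‖ ^ 2))
        calc _ ≤ 2 * n * deriv Real.smoothTransition ((n:ℝ) * (R ^ 2 - ‖y - a‖ ^ 2)) * (L * (R ^ 2 - ‖y - a‖ ^ 2)) := by
              apply mul_le_mul_of_nonneg_left h2
              exact mul_nonneg (by positivity) h3.1
          _ = 2 * deriv Real.smoothTransition ((n:ℝ) * (R ^ 2 - ‖y - a‖ ^ 2)) * L * ((n:ℝ) * (R ^ 2 - ‖y - a‖ ^ 2)) := by ring
          _ ≤ 2 * deriv Real.smoothTransition ((n:ℝ) * (R ^ 2 - ‖y - a‖ ^ 2)) * L * 1 := by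
              apply mul_le_mul_of_nonneg_left hy.2.le
              exact mul_nonneg (mul_nonneg (by norm_num) h3.1) hL0
          _ ≤ 2 * M * L := by
              rw [mul_one]; gcongr; exact h3.2
      · rw [indicator_of_notMem hy, deriv_st_zero]
        · simp
        · simp only [hS, mem_ofPred_eq, not_and_or, not_lt] at hy
          exact hy
    refine integral_mono ?_ ?_ hle
    · apply Continuous.integrable_of_hasCompactSupport
      · have hc : Continuous (deriv Real.smoothTransition) :=
          (Real.smoothTransition.contDiff (n := 1)).continuous_deriv (by norm_num)
        exact (continuous_const.mul (hc.comp (by fun_prop))).mul hΦc.continuous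
      · refine HasCompactSupport.intro (isCompact_closedBall a R) fun y hy => ?_
        rw [mem_closedBall, dist_eq_norm, not_le] at hy
        rw [deriv_st_zero, mul_zero, zero_mul]
        left
        have : R ^ 2 ≤ ‖y - a‖ ^ 2 := by gcongr
        exact mul_nonpos_of_nonneg_of_nonpos (Nat.cast_nonneg n) (by linarith)
    · rw [integrable_indicator_iff (hSm n)]
      exact integrableOn_const ((measure_mono (hSb n)).trans_lt measure_ball_lt_top).ne
  have lim1 : Tendsto (fun n => ∫ y, η n y * D y) atTop (𝓝 (∫ y, (ball a R).indicator D y)) := by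
    apply tendsto_integral_of_dominated_convergence ((ball a R).indicator fun y => |D y|)
    · intro n; exact ((hηs n).continuous.mul hDc).aestronglyMeasurable
    · rw [integrable_indicator_iff measurableSet_ball]
      exact (hDc.abs.continuousOn.integrableOn_compact (isCompact_closedBall a R)).mono_set ball_subset_closedBall
    · intro n; refine Eventually.of_forall fun y => ?_
      by_cases hy : y ∈ ball a R
      · rw [indicator_of_mem hy, norm_mul, Real.norm_eq_abs, Real.norm_eq_abs, abs_of_nonneg (Real.smoothTransition.nonneg _)]
        exact mul_le_of_le_one_left (abs_nonneg _) (Real.smoothTransition.le_one _)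
      · rw [indicator_of_notMem hy, hη0 n y hy]; simp
    · refine Eventually.of_forall fun y => ?_
      by_cases hy : y ∈ ball a R
      · rw [indicator_of_mem hy]
        apply tendsto_const_nhds.congr'
        have hq : 0 < R ^ 2 - ‖y - a‖ ^ 2 := by
          rw [mem_ball, dist_eq_norm] at hy
          have := pow_lt_pow_left₀ hy (norm_nonneg _) two_ne_zero
          linarith
        filter_upwards [(tendsto_natCast_atTop_atTop (R := ℝ)).eventually_ge_atTop (1 / (R ^ 2 - ‖y - a‖ ^ 2))] with n hn
        rw [div_le_iff₀ hq] at hn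
        simp only [hη]
        rw [Real.smoothTransition.one_of_one_le hn, one_mul]
      · rw [indicator_of_notMem hy]
        simp_rw [hη0 _ y hy, zero_mul]
        exact tendsto_const_nhds
  have lim2 : Tendsto (fun n => ∫ y, (S n).indicator (fun _ => 2 * M * L) y) atTop (𝓝 (∫ y : E4, (0:ℝ))) := by
    apply tendsto_integral_of_dominated_convergence ((ball a R).indicator fun y => 2 * M * L)
    · intro n; exact (measurable_const.indicator (hSm n)).aestronglyMeasurable
    · rw [integrable_indicator_iff measurableSet_ball]
      exact integrableOn_const (measure_ball_lt_top.ne)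
    · intro n; refine Eventually.of_forall fun y => ?_
      rw [Real.norm_eq_abs, abs_of_nonneg (indicator_nonneg (fun _ _ => by positivity) _)]
      exact indicator_le_indicator_of_subset (hSb n) (fun _ => by positivity) _
    · refine Eventually.of_forall fun y => ?_
      apply tendsto_const_nhds.congr'
      by_cases hq : 0 < R ^ 2 - ‖y - a‖ ^ 2
      · filter_upwards [(tendsto_natCast_atTop_atTop (R := ℝ)).eventually_ge_atTop (1 / (R ^ 2 - ‖y - a‖ ^ 2))] with n hn
        rw [div_le_iff₀ hq] at hn
        rw [indicator_of_notMem]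
        exact fun h => absurd h.2 (not_lt.2 hn)
      · refine Eventually.of_forall fun n => ?_
        refine (indicator_of_notMem ?_ _).symm
        exact fun h => hq (pos_of_mul_pos_right h.1 (Nat.cast_nonneg n))
  have := le_of_tendsto_of_tendsto' lim1 lim2 key
  rw [integral_indicator measurableSet_ball] at this
  simpa using this


lemma pd_eq {f : E4 → ℝ} {f' : E4 →L[ℝ] ℝ} {y : E4} (h : HasFDerivAt f f' y) (k : Fin 4) :
    pd k f y = f' (EuclideanSpace.single k 1) := by
  unfold pd; rw [h.fderiv]

lemma pd_mul {f g : E4 → ℝ} {y : E4} (hf : DifferentiableAt ℝ f y) (hg : DifferentiableAt ℝ g y)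
    (k : Fin 4) : pd k (fun z => f z * g z) y = pd k f y * g y + f y * pd k g y := by
  rw [pd_eq (hf.hasFDerivAt.fun_mul hg.hasFDerivAt)]
  simp [pd]; ring

lemma pd_sub {f g : E4 → ℝ} {y : E4} (hf : DifferentiableAt ℝ f y) (hg : DifferentiableAt ℝ g y)
    (k : Fin 4) : pd k (fun z => f z - g z) y = pd k f y - pd k g y := by
  rw [pd_eq (hf.hasFDerivAt.fun_sub hg.hasFDerivAt)]
  simp [pd]

lemma pd_inv {f : E4 → ℝ} {y : E4} (hf : DifferentiableAt ℝ f y) (h0 : f y ≠ 0)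
    (k : Fin 4) : pd k (fun z => (f z)⁻¹) y = - pd k f y * ((f y)⁻¹) ^ 2 := by
  have := (hasDerivAt_inv h0).comp_hasFDerivAt y hf.hasFDerivAt
  have h2 := pd_eq (f := fun z => (f z)⁻¹) this k
  rw [h2]
  simp [pd]; ring

lemma pd_coord (b : ℝ) (k : Fin 4) (y : E4) : pd k (fun z : E4 => z k - b) y = 1 := by
  have : HasFDerivAt (fun z : E4 => z k - b) (EuclideanSpace.proj k : E4 →L[ℝ] ℝ) y :=
    ((EuclideanSpace.proj k : E4 →L[ℝ] ℝ).hasFDerivAt).sub_const b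
  rw [pd_eq this]
  simp

lemma pd_nsq (b : E4) (ε : ℝ) (k : Fin 4) (y : E4) :
    pd k (fun z : E4 => ‖z - b‖ ^ 2 + ε) y = 2 * (y k - b k) := by
  rw [pd_eq ((hasFDerivAt_nsq b y).add_const ε)]
  simp only [_root_.smul_apply, innerSL_apply_apply, inner_single, smul_eq_mul, PiLp.sub_apply]

lemma cd_nsq (b : E4) {n : ℕ∞} : ContDiff ℝ n (fun z : E4 => ‖z - b‖ ^ 2) :=
  (contDiff_id.sub contDiff_const).norm_sq ℝ

lemma cd_alpha (b : E4) {ε : ℝ} (hε : 0 < ε) {n : ℕ∞} :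
    ContDiff ℝ n (fun z : E4 => (‖z - b‖ ^ 2 + ε)⁻¹) :=
  ((cd_nsq b).add contDiff_const).inv fun y => by positivity

lemma nsq_sum (z : E4) : ‖z‖ ^ 2 = ∑ k, z k ^ 2 := by
  rw [EuclideanSpace.norm_sq_eq]; simp

lemma abs_coord_le (z : E4) (k : Fin 4) : |z k| ≤ ‖z‖ := by
  simpa using PiLp.norm_apply_le z k

lemma intBall {f : E4 → ℝ} (hf : Continuous f) (a : E4) (R : ℝ) : IntegrableOn f (ball a R) :=
  (hf.continuousOn.integrableOn_compact (isCompact_closedBall a R)).mono_set ball_subset_closedBall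

lemma hardy_s13 (a b : E4) {R c ε : ℝ} (hR : 0 < R) (hc : 0 ≤ c) (hε : 0 < ε) (g : E4 → ℝ)
    (hg : ContDiff ℝ 1 g)
    (hb : ∀ y : E4, ‖y - a‖ = R → ∑ k, (y k - b k) * (y k - a k) ≤ c * R ^ 2 * ‖y - b‖ ^ 2) :
    2 * ∫ y in ball a R, |g y| * (‖y - b‖ ^ 2 + ε)⁻¹ ≤
      4 * c * (∫ y in ball a R, |g y|) +
        ∫ y in ball a R, (∑ k, |pd k g y|) * (‖y - b‖ * (‖y - b‖ ^ 2 + ε)⁻¹ + c * R) := by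
  set α : E4 → ℝ := fun y => (‖y - b‖ ^ 2 + ε)⁻¹ with hα
  have hαs : ContDiff ℝ 1 α := cd_alpha b hε (n := 1)
  have hα0 : ∀ y, 0 < α y := fun y => by simp only [hα]; positivity
  have hαe : ∀ y, α y * (‖y - b‖ ^ 2 + ε) = 1 := fun y => by
    simp only [hα]; exact inv_mul_cancel₀ (by positivity)
  have hpdg : Continuous fun y => ∑ k, |pd k g y| :=
    continuous_finsetSum _ fun k _ => (cont_pd hg k).abs
  have hgc := hg.continuous
  have hαc := hαs.continuous
  have main : ∀ δ > 0, 2 * ∫ y in ball a R, |g y| * α y ≤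
      4 * c * (∫ y in ball a R, |g y|) +
        (∫ y in ball a R, (∑ k, |pd k g y|) * (‖y - b‖ * α y + c * R)) +
        4 * c * (volume.real (ball a R)) * δ := by
    intro δ hδ
    set θ : E4 → ℝ := fun y => Real.sqrt (g y ^ 2 + δ ^ 2) with hθ
    have hθp : ∀ y, 0 < g y ^ 2 + δ ^ 2 := fun y => by positivity
    have hθs : ContDiff ℝ 1 θ := ((hg.pow 2).add contDiff_const).sqrt fun y => (hθp y).ne'
    have hθ1 : ∀ y, |g y| ≤ θ y := fun y => Real.abs_le_sqrt (by nlinarith [sq_nonneg δ])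
    have hθ2 : ∀ y, θ y ≤ |g y| + δ := fun y => by
      apply Real.sqrt_le_iff.2
      refine ⟨by positivity, ?_⟩
      nlinarith [sq_abs (g y), mul_nonneg (abs_nonneg (g y)) hδ.le]
    have hθ0 : ∀ y, 0 < θ y := fun y => Real.sqrt_pos.2 (hθp y)
    have hθd : ∀ k y, |pd k θ y| ≤ |pd k g y| := fun k y => by
      have h1 := (((hg.differentiable (by norm_num) y).hasFDerivAt.pow 2).add_const (δ^2)).sqrt (hθp y).ne'
      have h2 : pd k θ y = (1 / (2 * θ y)) * (2 * g y * pd k g y) := by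
        rw [pd_eq (f := θ) h1]
        simp [pd, hθ]
      rw [h2]
      have h3 : (1 / (2 * θ y)) * (2 * g y * pd k g y) = (g y / θ y) * pd k g y := by
        have := (hθ0 y).ne'
        field_simp
      rw [h3, abs_mul, abs_div, abs_of_pos (hθ0 y)]
      exact mul_le_of_le_one_left (abs_nonneg _) ((div_le_one (hθ0 y)).2 (hθ1 y))
    set V : Fin 4 → E4 → ℝ := fun k y => (y k - b k) * α y - c * (y k - a k) with hV
    have hVs : ∀ k, ContDiff ℝ 1 (V k) := fun k => by
      simp only [hV]; fun_prop
    have hdiv : ∀ y, 2 * α y - 4 * c ≤ ∑ k, pd k (V k) y := fun y => by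
      have h1 : ∀ k, pd k (V k) y = α y - 2 * (y k - b k) ^ 2 * α y ^ 2 - c := fun k => by
        have e1 : DifferentiableAt ℝ (fun z : E4 => z k - b k) y := by fun_prop
        have e2 : DifferentiableAt ℝ (fun z : E4 => z k - a k) y := by fun_prop
        have e3 : DifferentiableAt ℝ α y := hαs.differentiable (by norm_num) y
        have e4 : DifferentiableAt ℝ (fun z : E4 => ‖z - b‖ ^ 2 + ε) y :=
          ((cd_nsq b (n := 1)).differentiable (by norm_num) y).add_const ε
        have e5 : pd k α y = - (2 * (y k - b k)) * α y ^ 2 := by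
          have := pd_inv e4 (by positivity) k
          rw [pd_nsq] at this
          exact this
        simp only [hV]
        rw [pd_sub (e1.fun_mul e3) (e2.const_mul c), pd_mul e1 e3, pd_mul (differentiableAt_const c) e2,
          pd_coord, pd_coord, e5]
        simp [pd]; ring
      simp_rw [h1]
      have h2 := nsq_sum (y - b)
      simp only [PiLp.sub_apply, Fin.sum_univ_four] at h2 ⊢
      have h3 := hαe y
      have h4 : ‖y - b‖ ^ 2 * α y ≤ 1 := by nlinarith [hα0 y]
      have h5 : ‖y - b‖ ^ 2 * α y ^ 2 ≤ α y := by nlinarith [hα0 y]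
      rw [h2] at h5
      nlinarith
    have hVb : ∀ k y, y ∈ ball a R → |V k y| ≤ ‖y - b‖ * α y + c * R := fun k y hy => by
      simp only [hV]
      refine (abs_sub _ _).trans ?_
      rw [abs_mul, abs_mul, abs_of_pos (hα0 y), abs_of_nonneg hc]
      have h1 := abs_coord_le (y - b) k
      have h2 := abs_coord_le (y - a) k
      rw [mem_ball, dist_eq_norm] at hy
      simp only [PiLp.sub_apply] at h1 h2
      have := (hα0 y).le
      gcongr
      linarith
    have hdle := div_le a hR (fun k y => θ y * V k y) (fun k => hθs.mul (hVs k)) (fun y hy => by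
      have h1 : ∑ k, θ y * V k y * (y k - a k) =
          θ y * (α y * (∑ k, (y k - b k) * (y k - a k)) - c * R ^ 2) := by
        have h2 := nsq_sum (y - a)
        rw [hy] at h2
        simp only [hV, PiLp.sub_apply, Fin.sum_univ_four] at h2 ⊢
        rw [h2]; ring
      rw [h1]
      apply mul_nonpos_of_nonneg_of_nonpos (hθ0 y).le
      have h3 := hb y hy
      have h4 := hαe y
      have h5 : α y * (∑ k, (y k - b k) * (y k - a k)) ≤ α y * (c * R ^ 2 * ‖y - b‖ ^ 2) :=
        mul_le_mul_of_nonneg_left h3 (hα0 y).le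
      have h6 : α y * ‖y - b‖ ^ 2 ≤ 1 := by nlinarith [hα0 y]
      have h7 : c * R ^ 2 * (α y * ‖y - b‖ ^ 2) ≤ c * R ^ 2 * 1 :=
        mul_le_mul_of_nonneg_left h6 (by positivity)
      linarith)
    have hpt : ∀ y ∈ ball a R, 2 * (|g y| * α y) - 4 * c * |g y|
        - (∑ k, |pd k g y|) * (‖y - b‖ * α y + c * R) - 4 * c * δ
        ≤ ∑ k, pd k (fun y => θ y * V k y) y := fun y hy => by
      have h1 : ∑ k, pd k (fun y => θ y * V k y) y
          = (∑ k, pd k θ y * V k y) + θ y * ∑ k, pd k (V k) y := by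
        rw [Finset.mul_sum, ← Finset.sum_add_distrib]
        refine Finset.sum_congr rfl fun k _ => ?_
        exact pd_mul (hθs.differentiable (by norm_num) y) ((hVs k).differentiable (by norm_num) y) k
      rw [h1]
      have h2 : -((∑ k, |pd k g y|) * (‖y - b‖ * α y + c * R)) ≤ ∑ k, pd k θ y * V k y := by
        rw [Finset.sum_mul, ← Finset.sum_neg_distrib]
        refine Finset.sum_le_sum fun k _ => ?_
        have h3 : |pd k θ y * V k y| ≤ |pd k g y| * (‖y - b‖ * α y + c * R) := by
          rw [abs_mul]
          exact mul_le_mul (hθd k y) (hVb k y hy) (abs_nonneg _) (abs_nonneg _)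
        linarith [neg_abs_le (pd k θ y * V k y)]
      have h4 := mul_le_mul_of_nonneg_left (hdiv y) (hθ0 y).le
      have h5 := mul_le_mul_of_nonneg_right (hθ1 y) (hα0 y).le
      have h6 := mul_le_mul_of_nonneg_left (hθ2 y) hc
      nlinarith
    have i1 : IntegrableOn (fun y => 2 * (|g y| * α y)) (ball a R) := intBall (by fun_prop) a R
    have i2 : IntegrableOn (fun y => 4 * c * |g y|) (ball a R) := intBall (by fun_prop) a R
    have i3 : IntegrableOn (fun y => (∑ k, |pd k g y|) * (‖y - b‖ * α y + c * R)) (ball a R) :=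
      intBall (by fun_prop) a R
    have i4 : IntegrableOn (fun _ : E4 => 4 * c * δ) (ball a R) := intBall (by fun_prop) a R
    have i5 : IntegrableOn (fun y => ∑ k, pd k (fun y => θ y * V k y) y) (ball a R) :=
      intBall (continuous_finsetSum _ fun k _ => cont_pd (hθs.mul (hVs k)) k) a R
    have j1 : IntegrableOn (fun y => 2 * (|g y| * α y) - 4 * c * |g y|) (ball a R) :=
      intBall (by fun_prop) a R
    have j2 : IntegrableOn (fun y => 2 * (|g y| * α y) - 4 * c * |g y|
        - (∑ k, |pd k g y|) * (‖y - b‖ * α y + c * R)) (ball a R) := intBall (by fun_prop) a R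
    have j3 : IntegrableOn (fun y => 2 * (|g y| * α y) - 4 * c * |g y|
        - (∑ k, |pd k g y|) * (‖y - b‖ * α y + c * R) - 4 * c * δ) (ball a R) :=
      intBall (by fun_prop) a R
    have hm := setIntegral_mono_on j3 i5 measurableSet_ball hpt
    rw [integral_sub j2 i4, integral_sub j1 i3, integral_sub i1 i2,
      integral_const_mul, integral_const_mul] at hm
    simp only [setIntegral_const, smul_eq_mul] at hm
    linarith
  apply _root_.le_of_forall_pos_le_add
  intro e he
  set K := 4 * c * volume.real (ball a R) with hK
  have hK0 : 0 ≤ K := by positivity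
  have := main (e / (K + 1)) (by positivity)
  have h2 : K * (e / (K + 1)) ≤ e := by
    rw [← mul_div_assoc, div_le_iff₀ (by positivity)]; nlinarith
  linarith

lemma lap_kernel (x : E4) {s t ε : ℝ} (hε : 0 < ε) (hst : s * t = ‖x‖ ^ 2)
    (hq : ∀ y : E4, 0 ≤ s * ‖y‖ ^ 2 - 2 * inner ℝ x y + t) :
    ContDiff ℝ 2 (fun y : E4 => (s * ‖y‖ ^ 2 - 2 * inner ℝ x y + t + ε)⁻¹) ∧
    ∀ y, lap (fun y : E4 => (s * ‖y‖ ^ 2 - 2 * inner ℝ x y + t + ε)⁻¹) y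
      = - (8 * s * ε) * ((s * ‖y‖ ^ 2 - 2 * inner ℝ x y + t + ε)⁻¹) ^ 3 := by
  set q : E4 → ℝ := fun y => s * ‖y‖ ^ 2 - 2 * inner ℝ x y + t + ε with hqd
  have hqs : ContDiff ℝ 2 q := by
    have : ContDiff ℝ 2 (fun y : E4 => ‖y‖ ^ 2) := contDiff_norm_sq ℝ
    have h2 : ContDiff ℝ 2 (fun y : E4 => inner ℝ x y) := contDiff_const.inner ℝ contDiff_id
    exact (((contDiff_const.mul this).sub (contDiff_const.mul h2)).add contDiff_const).add contDiff_const
  have hq0 : ∀ y, 0 < q y := fun y => by have := hq y; simp only [hqd]; linarith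
  have hps : ContDiff ℝ 2 (fun y => (q y)⁻¹) := hqs.inv fun y => (hq0 y).ne'
  refine ⟨hps, fun y => ?_⟩
  have d1 : Differentiable ℝ q := hqs.differentiable (by norm_num)
  have d2 : Differentiable ℝ (fun y => (q y)⁻¹) := hps.differentiable (by norm_num)
  have hpq : ∀ k z, pd k q z = 2 * s * z k - 2 * x k := fun k z => by
    have h1 := hasFDerivAt_nsq 0 z
    simp only [sub_zero] at h1
    have h2 : HasFDerivAt (fun y : E4 => inner ℝ x y) (innerSL ℝ x) z := (innerSL ℝ x).hasFDerivAt
    have h3 : HasFDerivAt q _ z := (((h1.const_mul s).sub (h2.const_mul 2)).add_const t).add_const ε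
    rw [pd_eq h3]
    simp only [_root_.smul_apply, _root_.sub_apply, innerSL_apply_apply, inner_single, smul_eq_mul]
    ring
  have hp1 : ∀ k, pd k (fun y => (q y)⁻¹) = fun z => (2 * x k - 2 * s * z k) * ((q z)⁻¹ * (q z)⁻¹) := fun k => by
    ext z
    rw [pd_inv (d1 z) (hq0 z).ne', hpq]; ring
  have hp2 : ∀ k, pd k (pd k (fun y => (q y)⁻¹)) y = -2 * s * ((q y)⁻¹) ^ 2
      + 2 * (2 * s * y k - 2 * x k) ^ 2 * ((q y)⁻¹) ^ 3 := fun k => by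
    have e1 : DifferentiableAt ℝ (fun z : E4 => 2 * x k - 2 * s * z k) y := by fun_prop
    have e2 : pd k (fun z : E4 => 2 * x k - 2 * s * z k) y = - 2 * s := by
      have h0 : (fun z : E4 => 2 * x k - 2 * s * z k) = fun z => (2 * x k) - (2 * s) * (z k - 0) := by
        ext z; ring
      have e4 : DifferentiableAt ℝ (fun z : E4 => z k - 0) y := by fun_prop
      rw [h0, pd_sub (differentiableAt_const _) (e4.const_mul _),
        pd_mul (differentiableAt_const _) e4, pd_coord]
      simp [pd]
    have e3 := congrFun (hp1 k) y
    rw [hp1 k, pd_mul e1 ((d2 y).fun_mul (d2 y)), pd_mul (d2 y) (d2 y), e2, e3]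
    ring
  show ∑ k, pd k (pd k (fun y => (q y)⁻¹)) y = -(8 * s * ε) * ((q y)⁻¹) ^ 3
  simp only [hp2]
  have hx2 := nsq_sum x
  have hy2 := nsq_sum y
  have hxy : inner ℝ x y = ∑ k, x k * y k := by
    simp [PiLp.inner_apply, mul_comm]
  have hqe : (q y)⁻¹ * q y = 1 := inv_mul_cancel₀ (hq0 y).ne'
  have hS : ∑ k, (2 * s * y k - 2 * x k) ^ 2 = 4 * s * (q y - ε) := by
    simp only [hqd, hxy]
    simp only [Fin.sum_univ_four] at *
    rw [hx2] at hst
    rw [hy2]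
    linear_combination (-4) * hst
  simp only [Fin.sum_univ_four] at hS ⊢
  linear_combination (8 * s * ((q y)⁻¹) ^ 2) * hqe + (2 * ((q y)⁻¹) ^ 3) * hS

lemma lap_sub' {f g : E4 → ℝ} (hf : ContDiff ℝ 2 f) (hg : ContDiff ℝ 2 g) (y : E4) :
    lap (fun z => f z - g z) y = lap f y - lap g y := by
  unfold lap
  rw [← Finset.sum_sub_distrib]
  refine Finset.sum_congr rfl fun k _ => ?_
  have h1 : pd k (fun z => f z - g z) = fun z => pd k f z - pd k g z := by
    ext z; exact pd_sub (hf.differentiable (by norm_num) z) (hg.differentiable (by norm_num) z) k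
  have h2 : ∀ {f : E4 → ℝ}, ContDiff ℝ 2 f → DifferentiableAt ℝ (pd k f) y := fun h =>
    (((h.fderiv_right (m := 1) (by norm_num)).clm_apply contDiff_const).differentiable (by norm_num) y)
  rw [h1, pd_sub (h2 hf) (h2 hg)]

lemma cd_pd {f : E4 → ℝ} (h : ContDiff ℝ 2 f) (k : Fin 4) : ContDiff ℝ 1 (pd k f) :=
  (h.fderiv_right (m := 1) (by norm_num)).clm_apply contDiff_const

lemma cont_lap {f : E4 → ℝ} (h : ContDiff ℝ 2 f) : Continuous (lap f) :=
  continuous_finsetSum _ fun k _ => cont_pd (cd_pd h k) k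

lemma green0 (u G : E4 → ℝ) (hu : ContDiff ℝ 2 u) (hG : ContDiff ℝ 2 G)
    (hub : ∀ y : E4, ‖y‖ = 1 → u y = 0) (hGb : ∀ y : E4, ‖y‖ = 1 → G y = 0) :
    ∫ y in ball (0:E4) 1, u y * lap G y = ∫ y in ball (0:E4) 1, G y * lap u y := by
  have aux : ∀ u G : E4 → ℝ, ContDiff ℝ 2 u → ContDiff ℝ 2 G → (∀ y : E4, ‖y‖ = 1 → u y = 0) →
      (∀ y : E4, ‖y‖ = 1 → G y = 0) →
      ∫ y in ball (0:E4) 1, u y * lap G y ≤ ∫ y in ball (0:E4) 1, G y * lap u y := by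
    intro u G hu hG hub hGb
    have h := div_le 0 one_pos (fun k y => u y * pd k G y - G y * pd k u y)
      (fun k => ((hu.of_le (by norm_num)).mul (cd_pd hG k)).sub ((hG.of_le (by norm_num)).mul (cd_pd hu k)))
      (fun y hy => by
        rw [sub_zero] at hy
        simp [hub y hy, hGb y hy])
    have h1 : ∀ y, ∑ k, pd k (fun y => u y * pd k G y - G y * pd k u y) y
        = u y * lap G y - G y * lap u y := fun y => by
      unfold lap
      rw [Finset.mul_sum, Finset.mul_sum, ← Finset.sum_sub_distrib]
      refine Finset.sum_congr rfl fun k _ => ?_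
      have a1 := hu.differentiable (by norm_num) y
      have a2 := hG.differentiable (by norm_num) y
      have a3 := (cd_pd hu k).differentiable (by norm_num) y
      have a4 := (cd_pd hG k).differentiable (by norm_num) y
      rw [pd_sub (a1.fun_mul a4) (a2.fun_mul a3), pd_mul a1 a4, pd_mul a2 a3]
      ring
    simp_rw [h1] at h
    have j1 : IntegrableOn (fun y => u y * lap G y) (ball 0 1) :=
      intBall (hu.continuous.mul (cont_lap hG)) _ _
    have j2 : IntegrableOn (fun y => G y * lap u y) (ball 0 1) :=
      intBall (hG.continuous.mul (cont_lap hu)) _ _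
    rw [integral_sub j1 j2] at h
    linarith
  exact le_antisymm (aux u G hu hG hub hGb) (aux G u hG hu hGb hub)

lemma green (u : E4 → ℝ) (hu : ContDiff ℝ 2 u) (hub : ∀ y : E4, ‖y‖ = 1 → u y = 0)
    (x : E4) (hx : ‖x‖ < 1) {ε : ℝ} (hε : 0 < ε) :
    |∫ y in ball (0:E4) 1, u y * (8 * ε * ((‖y - x‖ ^ 2 + ε)⁻¹) ^ 3)| ≤
      8 * ε * (((1 - ‖x‖) ^ 2)⁻¹) ^ 3 * (∫ y in ball (0:E4) 1, |u y|) +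
      ∫ y in ball (0:E4) 1, |lap u y| * (‖y - x‖ ^ 2 + ε)⁻¹ := by
  have n1 : ∀ y : E4, 1 * ‖y‖ ^ 2 - 2 * inner ℝ x y + ‖x‖ ^ 2 = ‖y - x‖ ^ 2 := fun y => by
    rw [norm_sub_sq_real, real_inner_comm]; ring
  have n2 : ∀ y : E4, (1 - ‖x‖ * ‖y‖) ^ 2 ≤ ‖x‖ ^ 2 * ‖y‖ ^ 2 - 2 * inner ℝ x y + 1 := fun y => by
    have := real_inner_le_norm x y
    nlinarith
  obtain ⟨c1, l1⟩ := lap_kernel x (s := 1) (t := ‖x‖ ^ 2) hε (by ring) (fun y => by rw [n1]; positivity)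
  obtain ⟨c2, l2⟩ := lap_kernel x (s := ‖x‖ ^ 2) (t := 1) hε (by ring)
    (fun y => (sq_nonneg _).trans (n2 y))
  simp_rw [n1] at c1 l1
  set P1 : E4 → ℝ := fun y => (‖y - x‖ ^ 2 + ε)⁻¹ with hP1
  set P2 : E4 → ℝ := fun y => (‖x‖ ^ 2 * ‖y‖ ^ 2 - 2 * inner ℝ x y + 1 + ε)⁻¹ with hP2
  have h := green0 u (fun y => P1 y - P2 y) hu (c1.sub c2) hub (fun y hy => by
    simp only [hP1, hP2, sub_eq_zero]
    rw [← n1 y, hy]; congr 1; ring)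
  have h' : ∀ y, lap (fun y => P1 y - P2 y) y
      = -(8 * ε) * P1 y ^ 3 + 8 * ‖x‖ ^ 2 * ε * P2 y ^ 3 := fun y => by
    rw [lap_sub' c1 c2, l1, l2]; ring
  simp only [h'] at h
  have cu := hu.continuous
  have cl := cont_lap hu
  have cP1 : Continuous P1 := c1.continuous
  have cP2 : Continuous P2 := c2.continuous
  have e : ∫ y in ball (0:E4) 1, u y * (8 * ε * P1 y ^ 3) =
      (∫ y in ball (0:E4) 1, u y * (8 * ‖x‖ ^ 2 * ε * P2 y ^ 3)) -
      ∫ y in ball (0:E4) 1, (P1 y - P2 y) * lap u y := by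
    rw [← h, ← integral_sub (intBall (by fun_prop) _ _) (intBall (by fun_prop) _ _)]
    congr 1; ext y; ring
  have hP1' : ∀ y, 0 < P1 y := fun y => by simp only [hP1]; positivity
  have hd : 0 < (1 - ‖x‖) ^ 2 := by have : 0 < 1 - ‖x‖ := by linarith
                                    positivity
  have hP2' : ∀ y, 0 < P2 y := fun y => by
    have := (sq_nonneg _).trans (n2 y)
    simp only [hP2]; positivity
  have hP2b : ∀ y ∈ ball (0:E4) 1, P2 y ≤ ((1 - ‖x‖) ^ 2)⁻¹ := fun y hy => by
    rw [mem_ball_zero_iff] at hy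
    simp only [hP2]
    apply inv_anti₀ hd
    have h1 := n2 y
    have h2 : (1 - ‖x‖) ^ 2 ≤ (1 - ‖x‖ * ‖y‖) ^ 2 := by
      apply pow_le_pow_left₀ (by linarith)
      nlinarith [norm_nonneg x]
    linarith
  have hPle : ∀ y ∈ ball (0:E4) 1, P2 y ≤ P1 y := fun y hy => by
    rw [mem_ball_zero_iff] at hy
    simp only [hP1, hP2]
    apply inv_anti₀ (by positivity)
    rw [← n1 y]
    have a1 : ‖x‖ ^ 2 ≤ 1 := pow_le_one₀ (norm_nonneg _) hx.le
    have a2 : ‖y‖ ^ 2 ≤ 1 := pow_le_one₀ (norm_nonneg _) hy.le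
    nlinarith [mul_nonneg (sub_nonneg.2 a1) (sub_nonneg.2 a2)]
  show |∫ y in ball (0:E4) 1, u y * (8 * ε * P1 y ^ 3)| ≤ _ + ∫ y in ball (0:E4) 1, |lap u y| * P1 y
  rw [e]
  refine (abs_sub _ _).trans (add_le_add ?_ ?_)
  · refine (abs_integral_le_integral_abs).trans ?_
    rw [← integral_const_mul]
    refine setIntegral_mono_on (intBall (by fun_prop) _ _) (intBall (by fun_prop) _ _) measurableSet_ball
      fun y hy => ?_
    rw [abs_mul, mul_comm]
    apply mul_le_mul_of_nonneg_right _ (abs_nonneg _)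
    have a1 : ‖x‖ ^ 2 ≤ 1 := pow_le_one₀ (norm_nonneg _) hx.le
    have a3 := pow_le_pow_left₀ (hP2' y).le (hP2b y hy) 3
    have a4 := (hP2' y).le
    rw [abs_of_nonneg (by positivity)]
    calc 8 * ‖x‖ ^ 2 * ε * P2 y ^ 3 ≤ 8 * 1 * ε * P2 y ^ 3 := by gcongr
      _ ≤ 8 * 1 * ε * (((1 - ‖x‖) ^ 2)⁻¹) ^ 3 := by gcongr
      _ = _ := by ring
  · refine (abs_integral_le_integral_abs).trans ?_
    refine setIntegral_mono_on (intBall (by fun_prop) _ _) (intBall (by fun_prop) _ _) measurableSet_ball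
      fun y hy => ?_
    rw [abs_mul, mul_comm]
    apply mul_le_mul_of_nonneg_left _ (abs_nonneg _)
    rw [abs_of_nonneg (sub_nonneg.2 (hPle y hy))]
    linarith [hP2' y]


lemma lint_ball : ∃ K : ℝ≥0, ∀ (b : E4) (r : ℝ), 0 < r →
    ∫⁻ y in ball b r, ‖y - b‖ₑ⁻¹ ≤ K * ENNReal.ofReal (r ^ 3) := by
  refine ⟨(4 * volume.real (ball (0:E4) 1)).toNNReal, fun b r hr => ?_⟩
  have h1 : ∫⁻ y in ball b r, ‖y - b‖ₑ⁻¹ = ∫⁻ y : E4, (ball (0:E4) r).indicator (fun z => ‖z‖ₑ⁻¹) y := by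
    rw [← lintegral_indicator measurableSet_ball,
      ← lintegral_sub_right_eq_self (fun y => (ball (0:E4) r).indicator (fun z => ‖z‖ₑ⁻¹) y) b]
    congr 1; ext y
    simp only [indicator, mem_ball, dist_eq_norm, sub_zero]
  set h : ℝ → ℝ := (Iio r).indicator (fun t => t⁻¹) with hh
  have hh0 : ∀ z : E4, 0 ≤ h ‖z‖ := fun z => by
    simp only [hh, indicator]; split_ifs <;> positivity
  have h2 : ∫⁻ y : E4, (ball (0:E4) r).indicator (fun z => ‖z‖ₑ⁻¹) y = ∫⁻ y : E4, ENNReal.ofReal (h ‖y‖) := by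
    apply lintegral_congr_ae
    have : ∀ᵐ y : E4, y ≠ 0 := by simp [ae_iff]
    filter_upwards [this] with y hy
    by_cases hyr : ‖y‖ < r
    · rw [indicator_of_mem (by simpa using hyr), hh, indicator_of_mem (by simpa using hyr),
        ENNReal.ofReal_inv_of_pos (norm_pos_iff.2 hy), ofReal_norm]
    · rw [indicator_of_notMem (by simpa using hyr), hh, indicator_of_notMem (by simpa using hyr)]
      simp
  have e3 : ∀ y ∈ Ioi (0:ℝ), y ^ (Module.finrank ℝ E4 - 1) • h y = (Iio r).indicator (fun t => t ^ 2) y := by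
    intro y hy
    have hy' : y ≠ 0 := (mem_Ioi.1 hy).ne'
    simp only [hh, indicator, finrank_euclideanSpace, Fintype.card_fin]
    split_ifs
    · simp; field_simp
    · simp
  have hIoo : IntegrableOn (fun t : ℝ => t ^ 2) (Ioo 0 r) :=
    ((continuous_pow 2).continuousOn.integrableOn_compact isCompact_Icc).mono_set Ioo_subset_Icc_self
  have h3 : Integrable (fun y : E4 => h ‖y‖) := by
    rw [integrable_fun_norm_addHaar volume, integrableOn_congr_fun e3 measurableSet_Ioi,
      integrableOn_indicator_iff measurableSet_Iio]
    rwa [inter_comm, Ioi_inter_Iio]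
  rw [h1, h2, ← ofReal_integral_eq_lintegral_ofReal h3 (Eventually.of_forall hh0),
    integral_fun_norm_addHaar, setIntegral_congr_fun measurableSet_Ioi e3,
    setIntegral_indicator measurableSet_Iio, Ioi_inter_Iio]
  have h4 : ∫ t in Ioo 0 r, t ^ 2 ≤ r ^ 3 := by
    rw [← integral_Ioc_eq_integral_Ioo, ← intervalIntegral.integral_of_le hr.le, integral_pow]
    norm_num
    nlinarith [pow_pos hr 3]
  have h5 : (((4 * volume.real (ball (0:E4) 1)).toNNReal : ℝ≥0) : ℝ≥0∞)
      = ENNReal.ofReal (4 * volume.real (ball (0:E4) 1)) := rfl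
  rw [h5, ← ENNReal.ofReal_mul (by positivity)]
  apply ENNReal.ofReal_le_ofReal
  simp only [finrank_euclideanSpace, Fintype.card_fin, nsmul_eq_mul, smul_eq_mul]
  push_cast
  rw [← mul_assoc]
  gcongr

lemma lint_set : ∃ K : ℝ≥0, ∀ (b : E4) (E : Set E4), MeasurableSet E → volume E < ⊤ →
    ∫⁻ y in E, ‖y - b‖ₑ⁻¹ ≤ K * volume E ^ (3/4 : ℝ) := by
  obtain ⟨K, hK⟩ := lint_ball
  refine ⟨K + 1, fun b E hE hfin => ?_⟩
  rcases eq_or_ne (volume E) 0 with h0 | h0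
  · rw [Measure.restrict_eq_zero.2 h0]; simp
  set V := (volume E).toReal with hV
  have hVp : 0 < V := ENNReal.toReal_pos h0 hfin.ne
  have hVe : volume E = ENNReal.ofReal V := (ENNReal.ofReal_toReal hfin.ne).symm
  set r := V ^ (1/4 : ℝ) with hr
  have hrp : 0 < r := by positivity
  have e1 : r ^ 3 = V ^ (3/4 : ℝ) := by
    rw [hr, ← Real.rpow_natCast, ← Real.rpow_mul hVp.le]; norm_num
  have e2 : r⁻¹ * V = V ^ (3/4 : ℝ) := by
    rw [hr, ← Real.rpow_neg hVp.le]
    nth_rewrite 2 [← Real.rpow_one V]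
    rw [← Real.rpow_add hVp]; norm_num
  calc ∫⁻ y in E, ‖y - b‖ₑ⁻¹ ≤ ∫⁻ y in ball b r ∪ (E \ ball b r), ‖y - b‖ₑ⁻¹ := by
        apply lintegral_mono_set
        intro y hy
        by_cases h : y ∈ ball b r
        · exact Or.inl h
        · exact Or.inr ⟨hy, h⟩
    _ ≤ (∫⁻ y in ball b r, ‖y - b‖ₑ⁻¹) + ∫⁻ y in E \ ball b r, ‖y - b‖ₑ⁻¹ := lintegral_union_le _ _ _
    _ ≤ K * ENNReal.ofReal (r ^ 3) + ∫⁻ y in E \ ball b r, ENNReal.ofReal r⁻¹ := by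
        refine add_le_add (hK b r hrp) ?_
        refine setLIntegral_mono' (hE.diff measurableSet_ball) fun y hy => ?_
        rw [ENNReal.ofReal_inv_of_pos hrp, ENNReal.inv_le_inv, ← ofReal_norm]
        apply ENNReal.ofReal_le_ofReal
        have := hy.2
        rwa [mem_ball, dist_eq_norm, not_lt] at this
    _ ≤ K * ENNReal.ofReal (r ^ 3) + ENNReal.ofReal r⁻¹ * volume E := by
        rw [setLIntegral_const]
        gcongr
        exact sdiff_subset
    _ = (K + 1 : ℝ≥0) * volume E ^ (3/4 : ℝ) := by
        rw [hVe, ← ENNReal.ofReal_mul (by positivity), e1, e2, ENNReal.ofReal_rpow_of_pos hVp]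
        push_cast; ring

lemma lorentz_eq {α F : Type*} [MeasurableSpace α] [NormedAddCommGroup F] (μ : Measure α) (f : α → F) :
    ∫⁻ t in Ioi (0:ℝ), ENNReal.ofReal (t ^ (-(1/4) : ℝ)) * rearr μ f t ≤ lorentzNorm (4/3) 1 μ f := by
  unfold lorentzNorm
  rw [if_neg ENNReal.one_ne_top]
  simp only [ENNReal.toReal_one, ENNReal.rpow_one, div_one]
  refine setLIntegral_mono' measurableSet_Ioi fun t ht => ?_
  have ht' : 0 < t := ht
  have e1 : (1 / (4 / 3 : ℝ≥0∞)).toReal = 3/4 := by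
    simp [ENNReal.toReal_div]
  have hanti : ∀ s ∈ Ioc (0:ℝ) t, rearr μ f t ≤ rearr μ f s := fun s hs => by
    unfold rearr
    apply sInf_le_sInf
    intro x hx
    exact le_trans hx (ENNReal.ofReal_le_ofReal hs.2)
  have e2 : rearr μ f t ≤ rearrM μ f t := by
    unfold rearrM
    calc rearr μ f t = ENNReal.ofReal (1/t) * ∫⁻ s in Ioc (0:ℝ) t, rearr μ f t := by
          rw [setLIntegral_const, Real.volume_Ioc, sub_zero, mul_comm (rearr μ f t), ← mul_assoc,
            ← ENNReal.ofReal_mul (by positivity), one_div_mul_cancel ht'.ne', ENNReal.ofReal_one, one_mul]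
      _ ≤ _ := by
          exact mul_le_mul' le_rfl (setLIntegral_mono' measurableSet_Ioc hanti)
  rw [e1, ENNReal.ofReal_rpow_of_pos ht', mul_right_comm, ← ENNReal.ofReal_mul (by positivity)]
  have e3 : t ^ (3/4 : ℝ) * (1/t) = t ^ (-(1/4) : ℝ) := by
    rw [one_div, ← Real.rpow_neg_one, ← Real.rpow_add ht']; norm_num
  rw [e3]
  gcongr

lemma lambda_le {α F : Type*} [MeasurableSpace α] [NormedAddCommGroup F] (μ : Measure α)
    [IsFiniteMeasure μ] (f : α → F) :
    ∫⁻ s in Ioi (0:ℝ), distFn μ f (ENNReal.ofReal s) ^ (3/4 : ℝ) ≤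
      ∫⁻ t in Ioi (0:ℝ), ENNReal.ofReal (t ^ (-(1/4) : ℝ)) * rearr μ f t := by
  set l : ℝ → ℝ≥0∞ := fun s => distFn μ f (ENNReal.ofReal s) with hl
  have hlanti : Antitone l := fun s s' h => by
    apply measure_mono
    intro x hx
    exact lt_of_le_of_lt (ENNReal.ofReal_le_ofReal h) hx
  have hlm : Measurable l := hlanti.measurable
  have hlf : ∀ s, l s ≠ ⊤ := fun s => measure_ne_top _ _
  set Φ : ℝ → ℝ → ℝ≥0∞ := fun s t => {p : ℝ × ℝ | ENNReal.ofReal p.2 < l p.1}.indicator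
    (fun p => ENNReal.ofReal (p.2 ^ (-(1/4) : ℝ))) (s, t) with hΦ
  have hset : MeasurableSet {p : ℝ × ℝ | ENNReal.ofReal p.2 < l p.1} :=
    measurableSet_lt (by fun_prop) (by fun_prop)
  have hm : Measurable (Function.uncurry Φ) := by
    have : Measurable ({p : ℝ × ℝ | ENNReal.ofReal p.2 < l p.1}.indicator
      (fun p => ENNReal.ofReal (p.2 ^ (-(1/4) : ℝ)))) := by
      apply Measurable.indicator _ hset
      fun_prop
    exact this
  have step1 : ∀ s, l s ^ (3/4 : ℝ) ≤ ∫⁻ t in Ioi (0:ℝ), Φ s t := fun s => by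
    set L := (l s).toReal with hL
    have hLe : l s = ENNReal.ofReal L := (ENNReal.ofReal_toReal (hlf s)).symm
    rcases eq_or_lt_of_le (ENNReal.toReal_nonneg : 0 ≤ (l s).toReal) with h0 | h0
    · have : l s = 0 := by rw [hLe, hL, ← h0]; simp
      rw [this, ENNReal.zero_rpow_of_pos (by norm_num)]; exact zero_le
    · have hLp : 0 < L := h0
      calc l s ^ (3/4 : ℝ) = ∫⁻ t in Ioo (0:ℝ) L, ENNReal.ofReal (L ^ (-(1/4) : ℝ)) := by
            rw [setLIntegral_const, Real.volume_Ioo, sub_zero, hLe, ENNReal.ofReal_rpow_of_pos hLp,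
              ← ENNReal.ofReal_mul (by positivity)]
            congr 1
            nth_rewrite 3 [← Real.rpow_one L]
            rw [← Real.rpow_add hLp]; norm_num
        _ ≤ ∫⁻ t in Ioo (0:ℝ) L, Φ s t := by
            refine setLIntegral_mono' measurableSet_Ioo fun t ht => ?_
            simp only [hΦ]
            rw [indicator_of_mem]
            · apply ENNReal.ofReal_le_ofReal
              exact Real.rpow_le_rpow_of_nonpos ht.1 ht.2.le (by norm_num)
            · show ENNReal.ofReal t < l s
              rw [hLe]
              exact (ENNReal.ofReal_lt_ofReal_iff hLp).2 ht.2
        _ ≤ _ := lintegral_mono_set Ioo_subset_Ioi_self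
  calc ∫⁻ s in Ioi (0:ℝ), l s ^ (3/4 : ℝ) ≤ ∫⁻ s in Ioi (0:ℝ), ∫⁻ t in Ioi (0:ℝ), Φ s t :=
        lintegral_mono fun s => step1 s
    _ = ∫⁻ t in Ioi (0:ℝ), ∫⁻ s in Ioi (0:ℝ), Φ s t := lintegral_lintegral_swap hm.aemeasurable
    _ ≤ _ := by
        refine lintegral_mono fun t => ?_
        have hmt : MeasurableSet {s | ENNReal.ofReal t < l s} := measurableSet_lt measurable_const hlm
        have e1 : ∀ s, Φ s t = {s | ENNReal.ofReal t < l s}.indicator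
            (fun _ => ENNReal.ofReal (t ^ (-(1/4) : ℝ))) s := fun s => rfl
        simp_rw [e1]
        rw [lintegral_indicator hmt, setLIntegral_const, Measure.restrict_apply hmt]
        gcongr
        by_cases htop : rearr μ f t = ⊤
        · rw [htop]; exact le_top
        have hsub : {s | ENNReal.ofReal t < l s} ∩ Ioi 0 ⊆ Ioc 0 (rearr μ f t).toReal := by
          rintro s ⟨hs, hs0⟩
          refine ⟨hs0, ?_⟩
          rw [← ENNReal.ofReal_le_iff_le_toReal htop]
          unfold rearr
          apply le_sInf
          intro x hx
          by_contra hlt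
          rw [not_le] at hlt
          have : l s ≤ distFn μ f x := measure_mono fun y hy => lt_trans hlt hy
          exact absurd (this.trans hx) (not_le.2 hs)
        refine (measure_mono hsub).trans ?_
        rw [Real.volume_Ioc, sub_zero, ENNReal.ofReal_toReal htop]

lemma lorentz_pair : ∃ K : ℝ≥0, ∀ {F : Type} [NormedAddCommGroup F] (f : E4 → F), Continuous f →
    ∀ b : E4, ∫⁻ y in B1, ‖f y‖ₑ * ‖y - b‖ₑ⁻¹ ≤ K * lorentzNorm (4/3) 1 (volume.restrict B1) f := by
  obtain ⟨K, hK⟩ := lint_set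
  refine ⟨K, fun {F} _ f hf b => ?_⟩
  have hB : MeasurableSet B1 := measurableSet_ball
  have hBf : volume B1 < ⊤ := measure_ball_lt_top
  have : IsFiniteMeasure (volume.restrict B1) := ⟨by simpa using hBf⟩
  have hw : Measurable fun y : E4 => ‖y - b‖ₑ⁻¹ := by fun_prop
  have hfm : Measurable fun y => ‖f y‖ := hf.norm.measurable
  set ν := (volume.restrict B1).withDensity (fun y : E4 => ‖y - b‖ₑ⁻¹) with hν
  have h1 : ∫⁻ y in B1, ‖f y‖ₑ * ‖y - b‖ₑ⁻¹ = ∫⁻ y, ENNReal.ofReal ‖f y‖ ∂ν := by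
    rw [hν, lintegral_withDensity_eq_lintegral_mul _ hw hfm.ennreal_ofReal]
    congr 1; ext y
    simp [mul_comm]
  rw [h1, lintegral_eq_lintegral_meas_lt ν (Eventually.of_forall fun y => norm_nonneg _) hfm.aemeasurable]
  calc ∫⁻ t in Ioi (0:ℝ), ν {a | t < ‖f a‖}
      ≤ ∫⁻ t in Ioi (0:ℝ), K * distFn (volume.restrict B1) f (ENNReal.ofReal t) ^ (3/4 : ℝ) := by
        refine setLIntegral_mono' measurableSet_Ioi fun t ht => ?_
        have hm : MeasurableSet {a | t < ‖f a‖} := measurableSet_lt measurable_const hfm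
        have e : {x | ENNReal.ofReal t < (‖f x‖₊ : ℝ≥0∞)} = {a | t < ‖f a‖} := by
          ext x
          show ENNReal.ofReal t < (‖f x‖₊ : ℝ≥0∞) ↔ t < ‖f x‖
          rw [← enorm_eq_nnnorm, ← ofReal_norm, ENNReal.ofReal_lt_ofReal_iff_of_nonneg (mem_Ioi.1 ht).le]
        unfold distFn
        rw [e, hν, withDensity_apply _ hm, Measure.restrict_apply hm, Measure.restrict_restrict hm]
        exact hK b _ (hm.inter hB) ((measure_mono inter_subset_right).trans_lt hBf)
    _ = K * ∫⁻ t in Ioi (0:ℝ), distFn (volume.restrict B1) f (ENNReal.ofReal t) ^ (3/4 : ℝ) :=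
        lintegral_const_mul' _ _ ENNReal.coe_ne_top
    _ ≤ _ := by
        gcongr
        exact (lambda_le _ f).trans (lorentz_eq _ f)


lemma peak : ∃ κ : ℝ, 0 < κ ∧ ∀ u : E4 → ℝ, Continuous u → ∀ x : E4, ‖x‖ < 1 →
    Tendsto (fun c : ℝ => ∫ y in ball (0:E4) 1,
      u y * (8 * (c^2)⁻¹ * ((‖y - x‖^2 + (c^2)⁻¹)⁻¹)^3)) atTop (𝓝 (κ * u x)) := by
  have hInteg : Integrable (fun z : E4 => ((1 + ‖z‖^2)⁻¹)^3) := by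
    have := integrable_rpow_neg_one_add_norm_sq (E := E4) (μ := volume) (r := 6)
      (by simp [finrank_euclideanSpace]; norm_num)
    refine this.congr (Eventually.of_forall fun z => ?_)
    have hz : (0:ℝ) < 1 + ‖z‖^2 := by positivity
    show (1 + ‖z‖^2) ^ (-6/2 : ℝ) = ((1 + ‖z‖^2)⁻¹)^3
    rw [show (-6/2 : ℝ) = -((3:ℕ):ℝ) by norm_num, Real.rpow_neg hz.le, Real.rpow_natCast, inv_pow]
  have hcont : Continuous (fun z : E4 => ((1 + ‖z‖^2)⁻¹)^3) := by
    refine Continuous.pow (Continuous.inv₀ (by fun_prop) fun z => ?_) 3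
    positivity
  obtain ⟨κ, hκ⟩ : ∃ κ : ℝ, κ = ∫ z : E4, ((1 + ‖z‖^2)⁻¹)^3 := ⟨_, rfl⟩
  have hκp : 0 < κ := by
    rw [hκ]
    refine integral_pos_of_integrable_nonneg_nonzero (x := 0) hcont hInteg (fun z => ?_) ?_
    · show (0:ℝ) ≤ ((1 + ‖z‖^2)⁻¹)^3
      positivity
    · simp
  refine ⟨8 * κ, by positivity, fun u hu x hx => ?_⟩
  have hdecay : Tendsto (fun z : E4 => ‖z‖ ^ Module.finrank ℝ E4 * (κ⁻¹ * ((1 + ‖z‖^2)⁻¹)^3))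
      (Bornology.cobounded E4) (𝓝 0) := by
    have h1 : Tendsto (fun z : E4 => κ⁻¹ * (‖z‖)⁻¹) (Bornology.cobounded E4) (𝓝 0) := by
      have := (tendsto_inv_atTop_zero.comp (tendsto_norm_cobounded_atTop (E := E4))).const_mul κ⁻¹
      simpa using this
    have h2 : ∀ᶠ z : E4 in Bornology.cobounded E4, 1 ≤ ‖z‖ :=
      (tendsto_norm_cobounded_atTop (E := E4)).eventually_ge_atTop 1
    refine squeeze_zero' (Eventually.of_forall fun z => by positivity) ?_ h1
    filter_upwards [h2] with z hz
    simp only [finrank_euclideanSpace, Fintype.card_fin]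
    have hz0 : 0 < ‖z‖ := by linarith
    rw [mul_left_comm]
    refine mul_le_mul_of_nonneg_left ?_ (inv_nonneg.2 hκp.le)
    rw [inv_pow, ← div_eq_mul_inv, inv_eq_one_div, div_le_div_iff₀ (by positivity) hz0]
    nlinarith [pow_pos hz0 2, pow_pos hz0 4, pow_pos hz0 5, pow_le_pow_right₀ hz (show 5 ≤ 6 by norm_num)]
  have hp := tendsto_integral_comp_smul_smul_of_integrable' (μ := (volume : Measure E4))
    (φ := fun z => κ⁻¹ * ((1 + ‖z‖^2)⁻¹)^3) (fun z => by positivity)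
    (by rw [integral_const_mul, ← hκ]; exact inv_mul_cancel₀ hκp.ne') hdecay
    (g := (ball (0:E4) 1).indicator u) (x₀ := x)
    ((integrable_indicator_iff measurableSet_ball).2 (intBall hu 0 1)) (by
      have : (ball (0:E4) 1).indicator u =ᶠ[𝓝 x] u := by
        filter_upwards [isOpen_ball.mem_nhds (show x ∈ ball (0:E4) 1 by simpa using hx)] with y hy
        exact indicator_of_mem hy _
      exact hu.continuousAt.congr this.symm)
  rw [indicator_of_mem (by simpa using hx)] at hp
  refine (hp.const_mul (8 * κ)).congr' ?_
  filter_upwards [eventually_gt_atTop 0] with c hc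
  rw [← integral_const_mul, ← integral_indicator measurableSet_ball]
  congr 1; ext y
  by_cases hy : y ∈ ball (0:E4) 1
  · rw [indicator_of_mem hy, indicator_of_mem hy]
    simp only [finrank_euclideanSpace, Fintype.card_fin, smul_eq_mul]
    rw [norm_smul, norm_sub_rev x y, Real.norm_eq_abs, mul_pow, sq_abs]
    have e1 : ‖y - x‖^2 + (c^2)⁻¹ = (c^2)⁻¹ * (1 + c^2 * ‖y-x‖^2) := by field_simp; ring
    have hD : 0 < 1 + c^2 * ‖y-x‖^2 := by positivity
    rw [e1]
    field_simp
  · rw [indicator_of_notMem hy, indicator_of_notMem hy]; simp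

lemma wbound (G : E4 → ℝ) (hG : Continuous G) (hG0 : ∀ y, 0 ≤ G y) (a b : E4) {R s ε : ℝ}
    (hε : 0 < ε) (hs : 0 ≤ s) (hsub : ball a R ⊆ B1) (h : ∀ y ∈ ball a R, s * ‖y - b‖ ≤ 1) :
    ENNReal.ofReal (∫ y in ball a R, G y * (‖y-b‖*(‖y-b‖^2+ε)⁻¹ + s)) ≤
      2 * ∫⁻ y in B1, ENNReal.ofReal (G y) * ‖y - b‖ₑ⁻¹ := by
  have hc : Continuous fun y : E4 => G y * (‖y-b‖*(‖y-b‖^2+ε)⁻¹ + s) := by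
    refine hG.mul (Continuous.add (Continuous.mul (by fun_prop) (Continuous.inv₀ (by fun_prop) fun z => ?_))
      continuous_const)
    positivity
  rw [ofReal_integral_eq_lintegral_ofReal (intBall hc a R)
    (Eventually.of_forall fun y => mul_nonneg (hG0 y) (by positivity)),
    ← lintegral_const_mul' _ _ (by norm_num)]
  refine le_trans ?_ (lintegral_mono_set hsub)
  refine setLIntegral_mono' measurableSet_ball fun y hy => ?_
  rw [ENNReal.ofReal_mul (hG0 y), mul_left_comm]
  gcongr
  rcases eq_or_ne (y - b) 0 with h0 | h0
  · rw [h0]; simp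
  · have hp : 0 < ‖y-b‖ := norm_pos_iff.2 h0
    have e : 2 * ‖y-b‖ₑ⁻¹ = ENNReal.ofReal (2 * ‖y-b‖⁻¹) := by
      rw [ENNReal.ofReal_mul (by norm_num), ENNReal.ofReal_inv_of_pos hp, ofReal_norm]; simp
    rw [e]
    apply ENNReal.ofReal_le_ofReal
    have h1 : s ≤ ‖y-b‖⁻¹ := by
      rw [inv_eq_one_div, le_div_iff₀ hp]; exact h y hy
    have h2 : ‖y-b‖*(‖y-b‖^2+ε)⁻¹ ≤ ‖y-b‖⁻¹ := by
      rw [← div_eq_mul_inv, inv_eq_one_div, div_le_div_iff₀ (by positivity) hp]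
      nlinarith
    linarith

lemma realbound (g : E4 → ℝ) (hg : ContDiff ℝ 1 g) (x : E4) (hx : ‖x‖ < 1) :
    ∃ b : E4, ‖b‖ = 1 ∧ ∀ ε : ℝ, 0 < ε → ε ≤ (1 - ‖x‖)^2 →
      ∫ y in ball (0:E4) 1, |g y| * (‖y-x‖^2+ε)⁻¹ ≤ 10 * (∫ y in ball (0:E4) 1, |g y|)
      + 5 * (∫ y in ball (0:E4) 1, (∑ k, |pd k g y|) * (‖y-b‖*(‖y-b‖^2+ε)⁻¹ + 1/2))
      + ∫ y in ball x (1-‖x‖), (∑ k, |pd k g y|) * (‖y-x‖*(‖y-x‖^2+ε)⁻¹ + (1-‖x‖)⁻¹) := by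
  set d := 1 - ‖x‖ with hd
  have hdp : 0 < d := by linarith
  obtain ⟨b, hb1, hbx⟩ : ∃ b : E4, ‖b‖ = 1 ∧ ‖x - b‖ = d := by
    rcases eq_or_ne x 0 with h0 | h0
    · refine ⟨EuclideanSpace.single 0 1, by simp, by rw [hd, h0]; simp⟩
    · have hp : 0 < ‖x‖ := norm_pos_iff.2 h0
      refine ⟨‖x‖⁻¹ • x, by rw [norm_smul]; simp [hp.ne'], ?_⟩
      have : x - ‖x‖⁻¹ • x = (1 - ‖x‖⁻¹) • x := by rw [sub_smul, one_smul]
      have h1 : 1 - ‖x‖⁻¹ ≤ 0 := by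
        have := (one_le_inv₀ hp).2 hx.le
        linarith
      rw [this, norm_smul, Real.norm_eq_abs, abs_of_nonpos h1, hd]
      field_simp
      ring
  refine ⟨b, hb1, fun ε hε hεd => ?_⟩
  have hgc : Continuous g := hg.continuous
  have hci : ∀ z : E4, Continuous fun y : E4 => |g y| * (‖y-z‖^2+ε)⁻¹ := fun z => by
    refine hgc.abs.mul (Continuous.inv₀ (by fun_prop) fun y => ?_)
    positivity
  have hsub : ball x d ⊆ ball (0:E4) 1 := by
    apply ball_subset_ball'
    rw [dist_zero_right, hd]; linarith
  have H1 := hardy_s13 0 b (R := 1) (c := 1/2) one_pos (by norm_num) hε g hg (by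
    intro y hy
    rw [sub_zero] at hy
    have e1 : ∑ k, (y k - b k) * (y k - (0:E4) k) = (‖y-b‖^2 + ‖y‖^2 - ‖b‖^2)/2 := by
      rw [nsq_sum, nsq_sum, nsq_sum]
      simp only [Fin.sum_univ_four, PiLp.sub_apply, PiLp.zero_apply]
      ring
    rw [e1, hy, hb1]; linarith)
  have H2 := hardy_s13 x x (R := d) (c := (d^2)⁻¹) hdp (by positivity) hε g hg (by
    intro y hy
    have e1 : ∑ k, (y k - x k) * (y k - x k) = ‖y-x‖^2 := by
      rw [nsq_sum]
      simp only [Fin.sum_univ_four, PiLp.sub_apply]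
      ring
    rw [e1, inv_mul_cancel₀ (by positivity), one_mul])
  have hdd : (d^2)⁻¹ * d = d⁻¹ := by field_simp
  rw [hdd] at H2
  rw [mul_one] at H1
  have tri : ∀ y : E4, ‖y - b‖ ≤ ‖y - x‖ + d := fun y => by
    rw [← hbx]; exact norm_sub_le_norm_sub_add_norm_sub y x b
  have I1 : (d^2)⁻¹ * (∫ y in ball x d, |g y|) ≤ 5 * ∫ y in ball x d, |g y| * (‖y-b‖^2+ε)⁻¹ := by
    rw [← integral_const_mul, ← integral_const_mul]
    refine setIntegral_mono_on ((intBall hgc.abs x d).const_mul _) ((intBall (hci b) x d).const_mul _)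
      measurableSet_ball fun y hy => ?_
    have hy' : ‖y - x‖ < d := by rwa [mem_ball, dist_eq_norm] at hy
    have h3 : (d^2)⁻¹ ≤ 5 * (‖y-b‖^2+ε)⁻¹ := by
      rw [← div_eq_mul_inv, inv_eq_one_div, div_le_div_iff₀ (by positivity) (by positivity)]
      nlinarith [tri y, norm_nonneg (y-b), norm_nonneg (y-x)]
    calc (d^2)⁻¹ * |g y| ≤ (5 * (‖y-b‖^2+ε)⁻¹) * |g y| := by gcongr
      _ = _ := by ring
  have I2 : ∫ y in ball (0:E4) 1 \ ball x d, |g y| * (‖y-x‖^2+ε)⁻¹ ≤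
      10 * ∫ y in ball (0:E4) 1 \ ball x d, |g y| * (‖y-b‖^2+ε)⁻¹ := by
    rw [← integral_const_mul]
    refine setIntegral_mono_on ((intBall (hci x) 0 1).mono_set sdiff_subset)
      (((intBall (hci b) 0 1).mono_set sdiff_subset).const_mul _)
      (measurableSet_ball.diff measurableSet_ball) fun y hy => ?_
    have hy' : d ≤ ‖y - x‖ := by
      have := hy.2
      rwa [mem_ball, dist_eq_norm, not_lt] at this
    have h3 : (‖y-x‖^2+ε)⁻¹ ≤ 10 * (‖y-b‖^2+ε)⁻¹ := by
      rw [← div_eq_mul_inv, inv_eq_one_div, div_le_div_iff₀ (by positivity) (by positivity)]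
      nlinarith [tri y, norm_nonneg (y-b), norm_nonneg (y-x)]
    calc |g y| * (‖y-x‖^2+ε)⁻¹ ≤ |g y| * (10 * (‖y-b‖^2+ε)⁻¹) := by gcongr
      _ = _ := by ring
  have S : ∀ z : E4, ∫ y in ball (0:E4) 1, |g y| * (‖y-z‖^2+ε)⁻¹ =
      (∫ y in ball x d, |g y| * (‖y-z‖^2+ε)⁻¹) + ∫ y in ball (0:E4) 1 \ ball x d, |g y| * (‖y-z‖^2+ε)⁻¹ := by
    intro z
    rw [← setIntegral_union disjoint_sdiff_right (measurableSet_ball.diff measurableSet_ball)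
      (intBall (hci z) x d) ((intBall (hci z) 0 1).mono_set sdiff_subset), union_sdiff_cancel hsub]
  have A0 : 0 ≤ ∫ y in ball x d, (∑ k, |pd k g y|) * (‖y-x‖*(‖y-x‖^2+ε)⁻¹ + d⁻¹) :=
    integral_nonneg fun y => mul_nonneg (Finset.sum_nonneg fun k _ => abs_nonneg _) (by positivity)
  have Sb := S b
  rw [S x]
  linarith


lemma smooth_pd {E : Type*} [NormedAddCommGroup E] [NormedSpace ℝ E] {f : E4 → E}
    (hf : ContDiff ℝ (⊤ : ℕ∞) f) (k : Fin 4) : ContDiff ℝ (⊤ : ℕ∞) (pd k f) :=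
  (hf.fderiv_right (m := (⊤ : ℕ∞)) (by simp)).clm_apply contDiff_const

lemma smooth_lap {E : Type*} [NormedAddCommGroup E] [NormedSpace ℝ E] {f : E4 → E}
    (hf : ContDiff ℝ (⊤ : ℕ∞) f) : ContDiff ℝ (⊤ : ℕ∞) (lap f) :=
  ContDiff.sum fun k _ => smooth_pd (smooth_pd hf k) k

lemma scalar_est : ∃ C : ℝ≥0, ∀ {F : Type} [NormedAddCommGroup F] (u : E4 → ℝ) (N : E4 → F),
    ContDiff ℝ (⊤ : ℕ∞) u → Continuous N → (∀ k y, |pd k (lap u) y| ≤ ‖N y‖) →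
    (∀ y, ‖y‖ = 1 → u y = 0) → ∀ x : E4, ‖x‖ < 1 →
    ‖u x‖ₑ ≤ C * (lorentzNorm (4/3) 1 (volume.restrict B1) N + ∫⁻ y in B1, ‖lap u y‖ₑ) := by
  obtain ⟨K, hK⟩ := lorentz_pair
  obtain ⟨κ, hκ, hpk⟩ := peak
  refine ⟨(κ⁻¹).toNNReal * (48 * K + 10), fun {F} _ u N hu hN hle hub x hx => ?_⟩
  set L := lorentzNorm (4/3) 1 (volume.restrict B1) N with hL
  set J := ∫⁻ y in B1, ‖lap u y‖ₑ with hJ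
  set M : ℝ≥0∞ := 48 * K * L + 10 * J with hM
  have hlap := smooth_lap hu
  have hg1 : ContDiff ℝ 1 (lap u) := hlap.of_le (by norm_cast)
  have hu2 : ContDiff ℝ 2 u := hu.of_le (by norm_cast)
  have hd : 0 < 1 - ‖x‖ := by linarith
  have hGc : Continuous fun y => ∑ k, |pd k (lap u) y| :=
    continuous_finsetSum _ fun k _ => (cont_pd hg1 k).abs
  have hG0 : ∀ y, 0 ≤ ∑ k, |pd k (lap u) y| := fun y => Finset.sum_nonneg fun k _ => abs_nonneg _
  have hGL : ∀ b, ∫⁻ y in B1, ENNReal.ofReal (∑ k, |pd k (lap u) y|) * ‖y - b‖ₑ⁻¹ ≤ 4 * (K * L) := by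
    intro b
    refine le_trans ?_ (mul_le_mul' le_rfl (hK N hN b))
    rw [← lintegral_const_mul' _ _ (by norm_num)]
    refine lintegral_mono fun y => ?_
    rw [← mul_assoc]
    refine mul_le_mul' ?_ le_rfl
    have h4 : (4 : ℝ≥0∞) * ‖N y‖ₑ = ENNReal.ofReal (4 * ‖N y‖) := by
      rw [ENNReal.ofReal_mul (by norm_num), ofReal_norm]; simp
    rw [h4]
    apply ENNReal.ofReal_le_ofReal
    rw [Fin.sum_univ_four]
    linarith [hle 0 y, hle 1 y, hle 2 y, hle 3 y]
  have hJr : ENNReal.ofReal (∫ y in ball (0:E4) 1, |lap u y|) = J := by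
    rw [ofReal_integral_eq_lintegral_ofReal (intBall hlap.continuous.abs 0 1)
      (Eventually.of_forall fun y => abs_nonneg _), hJ]
    refine lintegral_congr fun y => ?_
    rw [← Real.norm_eq_abs, ofReal_norm]
  obtain ⟨b, hb1, hb⟩ := realbound (lap u) hg1 x hx
  have main : ∀ ε : ℝ, 0 < ε → ε ≤ (1 - ‖x‖)^2 →
      ENNReal.ofReal (∫ y in ball (0:E4) 1, |lap u y| * (‖y-x‖^2+ε)⁻¹) ≤ M := by
    intro ε hε hεd
    have w1 := (wbound _ hGc hG0 0 b (R := 1) (s := 1/2) hε (by norm_num) (subset_refl B1) (by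
      intro y hy
      have h1 : ‖y‖ < 1 := by simpa using hy
      have := norm_sub_le y b
      linarith)).trans (mul_le_mul' le_rfl (hGL b))
    have w2 := (wbound _ hGc hG0 x x (R := 1 - ‖x‖) (s := (1 - ‖x‖)⁻¹) hε (by positivity) (by
      apply ball_subset_ball'
      rw [dist_zero_right]; linarith) (by
      intro y hy
      have h1 : ‖y - x‖ < 1 - ‖x‖ := by rwa [mem_ball, dist_eq_norm] at hy
      rw [inv_mul_le_iff₀ hd]; linarith)).trans (mul_le_mul' le_rfl (hGL x))
    refine (ENNReal.ofReal_le_ofReal (hb ε hε hεd)).trans ?_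
    refine ENNReal.ofReal_add_le.trans ?_
    refine (add_le_add ENNReal.ofReal_add_le w2).trans ?_
    rw [ENNReal.ofReal_mul (by norm_num), ENNReal.ofReal_mul (by norm_num), hJr]
    refine (add_le_add (add_le_add le_rfl (mul_le_mul' le_rfl w1)) le_rfl).trans ?_
    rw [hM]
    apply le_of_eq
    simp only [ENNReal.ofReal_ofNat]
    ring
  set Q := ∫ y in ball (0:E4) 1, |u y| with hQ
  have lim0 : Tendsto (fun c : ℝ => (c^2)⁻¹) atTop (𝓝 0) :=
    tendsto_inv_atTop_zero.comp (tendsto_pow_atTop (by norm_num))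
  have limr : Tendsto (fun c : ℝ => ENNReal.ofReal (8 * (c^2)⁻¹ * (((1-‖x‖)^2)⁻¹)^3 * Q) + M) atTop (𝓝 M) := by
    have h1 : Tendsto (fun c : ℝ => 8 * (c^2)⁻¹ * (((1-‖x‖)^2)⁻¹)^3 * Q) atTop (𝓝 0) := by
      have := ((lim0.const_mul 8).mul_const ((((1-‖x‖)^2)⁻¹)^3)).mul_const Q
      simpa using this
    have h2 := (ENNReal.tendsto_ofReal h1).add (tendsto_const_nhds (x := M))
    simpa using h2
  have liml := ENNReal.tendsto_ofReal ((hpk u hu.continuous x hx).abs)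
  have key : ENNReal.ofReal |κ * u x| ≤ M := by
    refine le_of_tendsto_of_tendsto liml limr ?_
    filter_upwards [eventually_gt_atTop 0, lim0.eventually_le_const (show (0:ℝ) < (1-‖x‖)^2 by positivity)]
      with c hc hcd
    have hε : 0 < (c^2)⁻¹ := by positivity
    refine (ENNReal.ofReal_le_ofReal (green u hu2 hub x hx hε)).trans ?_
    exact ENNReal.ofReal_add_le.trans (add_le_add le_rfl (main _ hε hcd))
  have e1 : ‖u x‖ₑ = ENNReal.ofReal κ⁻¹ * ENNReal.ofReal |κ * u x| := by
    rw [← ENNReal.ofReal_mul (by positivity), abs_mul, abs_of_pos hκ, ← mul_assoc,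
      inv_mul_cancel₀ hκ.ne', one_mul, ← Real.norm_eq_abs, ofReal_norm]
  rw [e1]
  refine (mul_le_mul' le_rfl key).trans ?_
  push_cast
  rw [show (((κ⁻¹).toNNReal : ℝ≥0) : ℝ≥0∞) = ENNReal.ofReal κ⁻¹ from rfl, mul_assoc]
  refine mul_le_mul' le_rfl ?_
  rw [hM, mul_add]
  refine add_le_add (mul_le_mul' le_self_add le_rfl) (mul_le_mul' le_add_self le_rfl)

lemma pd_comp {m : ℕ} {f : E4 → Fin m → ℝ} (hf : Differentiable ℝ f) (i : Fin m) (k : Fin 4) :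
    pd k (fun y => f y i) = fun y => pd k f y i := by
  ext y
  have h := (hf y).hasFDerivAt
  have h2 := (hasFDerivAt_pi'.1 h i).fderiv
  unfold pd
  rw [h2]; rfl

lemma lap_comp {m : ℕ} {f : E4 → Fin m → ℝ} (hf : ContDiff ℝ (⊤ : ℕ∞) f) (i : Fin m) :
    lap (fun y => f y i) = fun y => lap f y i := by
  ext y
  unfold lap
  rw [Finset.sum_apply]
  refine Finset.sum_congr rfl fun k _ => ?_
  rw [pd_comp (hf.differentiable (by simp)), pd_comp ((smooth_pd hf k).differentiable (by simp))]

lemma lap_le {m : ℕ} {f : E4 → Fin m → ℝ} (hf : ContDiff ℝ (⊤ : ℕ∞) f) (y : E4) :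
    ‖lap f y‖ ≤ 4 * ‖iteratedFDeriv ℝ 2 f y‖ := by
  have h : ∀ k, ‖pd k (pd k f) y‖ ≤ ‖iteratedFDeriv ℝ 2 f y‖ := fun k => by
    have hd : DifferentiableAt ℝ (fderiv ℝ f) y :=
      (hf.fderiv_right (m := (⊤ : ℕ∞)) (by simp)).differentiable (by simp) y
    have e : pd k (pd k f) y = iteratedFDeriv ℝ 2 f y
        ![EuclideanSpace.single k 1, EuclideanSpace.single k 1] := by
      rw [iteratedFDeriv_two_apply]
      unfold pd
      rw [fderiv_clm_apply hd (differentiableAt_const _)]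
      simp
    rw [e]
    refine (ContinuousMultilinearMap.le_opNorm _ _).trans ?_
    simp
  unfold lap
  refine (norm_sum_le _ _).trans ?_
  refine (Finset.sum_le_sum fun k _ => h k).trans ?_
  simp

lemma sob_bound : ∃ C : ℝ≥0, ∀ {m : ℕ} (u : E4 → Fin m → ℝ), ContDiff ℝ (⊤ : ℕ∞) u →
    ∫⁻ y in B1, ‖lap u y‖ₑ ≤ C * sobNorm 2 2 B1 u := by
  have hBf : volume B1 < ⊤ := measure_ball_lt_top
  refine ⟨4 * ((volume B1) ^ (1/2 : ℝ)).toNNReal, fun {m} u hu => ?_⟩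
  have hV : (((volume B1) ^ (1/2 : ℝ)).toNNReal : ℝ≥0∞) = (volume B1) ^ (1/2 : ℝ) :=
    ENNReal.coe_toNNReal (ENNReal.rpow_ne_top_of_nonneg (by norm_num) hBf.ne)
  push_cast
  rw [hV, ← eLpNorm_one_eq_lintegral_enorm]
  have h1 := eLpNorm_le_eLpNorm_mul_rpow_measure_univ (μ := volume.restrict B1) (f := lap u)
    (p := 1) (q := 2) (by norm_num) ((smooth_lap hu).continuous.aestronglyMeasurable)
  refine h1.trans ?_
  have e1 : (1 / (1 : ℝ≥0∞).toReal - 1 / (2 : ℝ≥0∞).toReal) = 1/2 := by norm_num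
  rw [e1, Measure.restrict_apply_univ]
  have h2 : eLpNorm (lap u) 2 (volume.restrict B1) ≤
      4 * eLpNorm (fun x => ‖iteratedFDeriv ℝ 2 u x‖) 2 (volume.restrict B1) := by
    have := eLpNorm_le_mul_eLpNorm_of_ae_le_mul (μ := volume.restrict B1) (f := lap u)
      (g := fun x => ‖iteratedFDeriv ℝ 2 u x‖) (c := 4)
      (Eventually.of_forall fun y => by simpa using lap_le hu y) 2
    simpa using this
  have h3 : eLpNorm (fun x => ‖iteratedFDeriv ℝ 2 u x‖) 2 (volume.restrict B1) ≤ sobNorm 2 2 B1 u := by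
    unfold sobNorm
    exact Finset.single_le_sum (f := fun i => eLpNorm (fun x => ‖iteratedFDeriv ℝ i u x‖) 2 (volume.restrict B1))
      (fun _ _ => zero_le) (by simp)
  calc _ ≤ (4 * sobNorm 2 2 B1 u) * volume B1 ^ (1/2 : ℝ) := by
        exact mul_le_mul' (h2.trans (mul_le_mul' le_rfl h3)) le_rfl
    _ = _ := by ring



/-- second part of the fourth-order Wente estimate. If a smooth
`u₂` solves `−Δ²u₂ = div f` in `B⁴` with `u₂ = ∂Δu₂/∂ν = 0` on `∂B⁴`, `∫ Δu₂ = 0` and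
`f ∈ L^{4/3,1}`, then `‖u₂‖_{L^∞} ≤ C (‖∇Δu₂‖_{L^{4/3,1}} + ‖u₂‖_{W^{2,2}})`. -/
theorem stmt13 :
    ∃ C : ℝ≥0, 0 < C ∧
      ∀ (m : ℕ) (u₂ : E4 → Fin m → ℝ) (f : E4 → Fin 4 → Fin m → ℝ),
        ContDiff ℝ (⊤ : ℕ∞) u₂ →
        MemLorentz (4 / 3) 1 (volume.restrict B1) f →
        (∀ x ∈ B1, - bilap u₂ x = ∑ k : Fin 4, pd k (fun y => f y k) x) →
        (∀ x : E4, ‖x‖ = 1 → u₂ x = 0 ∧ fderiv ℝ (lap u₂) x x = 0) →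
        (∫ x in B1, lap u₂ x) = 0 →
        ∀ x ∈ B1,
          (‖u₂ x‖₊ : ℝ≥0∞)
            ≤ C * (lorentzNorm (4 / 3) 1 (volume.restrict B1)
                    (fun y => fun k : Fin 4 => pd k (lap u₂) y)
                + sobNorm 2 2 B1 u₂) := by
  obtain ⟨C1, h1⟩ := scalar_est
  obtain ⟨C2, h2⟩ := sob_bound
  refine ⟨C1 * (1 + C2) + 1, by positivity, ?_⟩
  intro m u₂ f hu _ _ hbd _ x hx
  have hx1 : ‖x‖ < 1 := by simpa [B1] using hx
  set L := lorentzNorm (4 / 3) 1 (volume.restrict B1) (fun y => fun k : Fin 4 => pd k (lap u₂) y)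
  have hlap := smooth_lap hu
  have hcomp : ∀ i, ‖u₂ x i‖ₑ ≤ (C1 * (1 + C2) + 1 : ℝ≥0) * (L + sobNorm 2 2 B1 u₂) := by
    intro i
    have hui : ContDiff ℝ (⊤ : ℕ∞) (fun y => u₂ y i) := contDiff_pi.1 hu i
    have h := h1 (fun y => u₂ y i) (fun y => fun k : Fin 4 => pd k (lap u₂) y) hui
      (continuous_pi fun k => (smooth_pd hlap k).continuous) (by
        intro k y
        rw [lap_comp hu, pd_comp (hlap.differentiable (by simp))]
        rw [← Real.norm_eq_abs]
        exact (norm_le_pi_norm (pd k (lap u₂) y) i).trans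
          (norm_le_pi_norm (fun k : Fin 4 => pd k (lap u₂) y) k))
      (fun y hy => by simp [(hbd y hy).1]) x hx1
    refine h.trans ?_
    have hJ : ∫⁻ y in B1, ‖lap (fun y => u₂ y i) y‖ₑ ≤ C2 * sobNorm 2 2 B1 u₂ := by
      refine le_trans (lintegral_mono fun y => ?_) (h2 u₂ hu)
      rw [lap_comp hu]
      rw [← ofReal_norm, ← ofReal_norm]
      exact ENNReal.ofReal_le_ofReal (norm_le_pi_norm (lap u₂ y) i)
    calc (C1 : ℝ≥0∞) * (L + ∫⁻ y in B1, ‖lap (fun y => u₂ y i) y‖ₑ)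
        ≤ C1 * ((1 + C2) * L + (1 + C2) * sobNorm 2 2 B1 u₂) := by
          refine mul_le_mul' le_rfl (add_le_add ?_ (hJ.trans (mul_le_mul' le_add_self le_rfl)))
          calc L = 1 * L := (one_mul L).symm
            _ ≤ _ := mul_le_mul' le_self_add le_rfl
      _ = (C1 * (1 + C2)) * (L + sobNorm 2 2 B1 u₂) := by ring
      _ ≤ _ := by
          push_cast
          exact mul_le_mul' le_self_add le_rfl
  rw [← enorm_eq_nnnorm]
  rcases eq_or_ne ((C1 * (1 + C2) + 1 : ℝ≥0) * (L + sobNorm 2 2 B1 u₂)) ⊤ with ht | ht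
  · rw [ht]; exact le_top
  · rw [← ofReal_norm]
    apply ENNReal.ofReal_le_of_le_toReal
    rw [pi_norm_le_iff_of_nonneg ENNReal.toReal_nonneg]
    intro i
    rw [← ENNReal.ofReal_le_iff_le_toReal ht, ofReal_norm]
    exact hcomp i
end
end
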